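/- arXiv:1601.00748 — 3 statements merged into one kernel-verified Lean document; each statement's English description precedes it below -/
import Mathlib

section
/- Let R be a Dedekind domain with fraction field K. Let A be an associative unital R-algebra and B a left A-module such that both A and B are flat as R-modules. Then B is flat as a left A-module if and only if B ⊗_R k is flat as a left (A ⊗_R k)-module for k = K and for k = R/m for every maximal ideal m of R. -/
open TensorProduct

/-- Flatness of a left module over a possibly noncommutative ring, expressed by
Lazard's equational criterion: every linear relation `∑ aᵢ • bᵢ = 0` with
coefficients in the ring trivializes. This is equivalent to exactness of the
functor `(-) ⊗_A B` on right `A`-modules. -/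
def IsFlatMod (A B : Type*) [Ring A] [AddCommGroup B] [Module A B] : Prop :=
  ∀ (n : ℕ) (a : Fin n → A) (b : Fin n → B), (∑ i, a i • b i) = 0 →
    ∃ (m : ℕ) (c : Fin n → Fin m → A) (y : Fin m → B),
      (∀ i, b i = ∑ j, c i j • y j) ∧ ∀ j, (∑ i, a i * c i j) = 0

/-- Faithful flatness of a left module `B` over a possibly noncommutative ring `A`:
`B` is flat, and `I • B ≠ B` for every proper right ideal `I` of `A`. This is
equivalent to the functor `(-) ⊗_A B` on right `A`-modules being exact and killing
only the zero module. -/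
def IsFaithfullyFlatMod (A B : Type*) [Ring A] [AddCommGroup B] [Module A B] : Prop :=
  IsFlatMod A B ∧
    ∀ I : Submodule Aᵐᵒᵖ A, I ≠ ⊤ →
      AddSubgroup.closure {x : B | ∃ a ∈ I, ∃ y : B, x = a • y} ≠ ⊤

section FiberModule

variable (R A B k : Type*) [CommRing R] [Ring A] [Algebra R A]
  [AddCommGroup B] [Module R B] [Module A B] [IsScalarTower R A B]
  [CommRing k] [Algebra R k]

instance (priority := low) smulCommClass_of_isScalarTower : SMulCommClass R A B :=
  ⟨fun r a b => by
    rw [← algebraMap_smul A r b, ← algebraMap_smul A r (a • b), ← mul_smul, ← mul_smul,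
      Algebra.commutes]⟩

/-- The action of `k` on the right tensor factor of `B ⊗[R] k`, packaged as a ring
homomorphism `End R k →+* End R (B ⊗[R] k)`. -/
noncomputable def lTensorEndHom : Module.End R k →+* Module.End R (B ⊗[R] k) where
  toFun f := LinearMap.lTensor B f
  map_zero' := LinearMap.lTensor_zero B
  map_add' := LinearMap.lTensor_add B
  map_one' := LinearMap.lTensor_id B k
  map_mul' f g := LinearMap.lTensor_comp B f g

/-- The `k`-module structure on `B ⊗[R] k` (action on the right factor). -/
noncomputable def kAction : Module k (B ⊗[R] k) :=
  Module.compHom _ ((lTensorEndHom R B k).comp (Module.toModuleEnd R k))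

/-- The natural `A ⊗[R] k`-module structure on the base change `B ⊗[R] k`:
`(a ⊗ c) • (b ⊗ d) = (a • b) ⊗ (c * d)`. -/
noncomputable def fiberModule : Module (A ⊗[R] k) (B ⊗[R] k) := by
  letI : Module k (B ⊗[R] k) := kAction R B k
  haveI h1 : ∀ (c : k) (b : B) (d : k), c • (b ⊗ₜ[R] d) = b ⊗ₜ[R] (c • d) := fun _ _ _ => rfl
  letI : SMulCommClass A k (B ⊗[R] k) := by
    constructor
    intro a c x
    induction x with
    | zero => simp
    | tmul b d => rw [h1, smul_tmul', smul_tmul', h1]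
    | add x y hx hy => simp only [smul_add, hx, hy]
  letI : IsScalarTower R k (B ⊗[R] k) := by
    constructor
    intro r c x
    induction x with
    | zero => simp
    | tmul b d => rw [h1, h1, smul_assoc, ← smul_tmul]; exact (smul_tmul' r b (c • d)).symm
    | add x y hx hy => simp only [smul_add, hx, hy]
  exact TensorProduct.Algebra.module

end FiberModule

section EquationalCriterion

variable {A B : Type*} [Ring A] [AddCommGroup B] [Module A B]

/-- Trivialization of a relation indexed by an arbitrary finite type. -/
lemma IsFlatMod.exists_of_fintype (h : IsFlatMod A B) {ι : Type*} [Fintype ι]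
    (a : ι → A) (b : ι → B) (hab : ∑ i, a i • b i = 0) :
    ∃ (m : ℕ) (c : ι → Fin m → A) (y : Fin m → B),
      (∀ i, b i = ∑ j, c i j • y j) ∧ ∀ j, ∑ i, a i * c i j = 0 := by
  let e := Fintype.equivFin ι
  obtain ⟨m, c, y, hb, hc⟩ := h _ (a ∘ e.symm) (b ∘ e.symm)
    (by rw [← hab]; exact e.symm.sum_comp fun i => a i • b i)
  refine ⟨m, fun i => c (e i), y, fun i => by simpa using hb (e i), fun j => ?_⟩
  rw [← hc j, ← e.sum_comp]
  simp

/-- Simultaneous trivialization of finitely many relations. -/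
lemma IsFlatMod.exists_of_matrix (h : IsFlatMod A B) {ι κ : Type*} [Fintype ι]
    (s : Finset κ) (a : κ → ι → A) (b : ι → B) (hab : ∀ k ∈ s, ∑ i, a k i • b i = 0) :
    ∃ (m : ℕ) (c : ι → Fin m → A) (y : Fin m → B),
      (∀ i, b i = ∑ j, c i j • y j) ∧ ∀ k ∈ s, ∀ j, ∑ i, a k i * c i j = 0 := by
  classical
  induction s using Finset.induction_on with
  | empty =>
    obtain ⟨m, c, y, hb, -⟩ := h.exists_of_fintype (fun _ : ι => (0 : A)) b (by simp)
    exact ⟨m, c, y, hb, by simp⟩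
  | insert k s _ ih =>
    obtain ⟨m, c, y, hb, hc⟩ := ih fun k' hk' => hab k' (Finset.mem_insert_of_mem hk')
    have hy : ∑ j, (∑ i, a k i * c i j) • y j = 0 := by
      rw [← hab k (Finset.mem_insert_self k s)]
      simp_rw [hb, Finset.smul_sum, Finset.sum_smul, mul_smul]
      exact Finset.sum_comm
    obtain ⟨p, d, z, hyz, hd⟩ := h.exists_of_fintype _ y hy
    have key (k' : κ) (l : Fin p) :
        ∑ i, a k' i * ∑ j, c i j * d j l = ∑ j, (∑ i, a k' i * c i j) * d j l := by
      simp_rw [Finset.mul_sum, Finset.sum_mul, mul_assoc]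
      exact Finset.sum_comm
    refine ⟨p, fun i l => ∑ j, c i j * d j l, z, fun i => ?_, fun k' hk' l => ?_⟩
    · rw [hb i]
      simp_rw [hyz, Finset.smul_sum, Finset.sum_smul, mul_smul]
      exact Finset.sum_comm
    · rw [key]
      rcases Finset.mem_insert.mp hk' with rfl | hk'
      · exact hd l
      · simp [hc k' hk']

end EquationalCriterion

section RelationSpan

variable (R : Type*) [CommRing R] {A B : Type*} [Ring A]
  [AddCommGroup B] [Module R B] [Module A B]

/-- The `R`-submodule of `ι → B` generated by the vectors `(cᵢ • y)ᵢ` with `∑ aᵢ * cᵢ = 0`. -/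
def relationSpan {ι : Type*} [Fintype ι] (a : ι → A) : Submodule R (ι → B) :=
  Submodule.span R {v | ∃ c : ι → A, ∃ y : B, ∑ i, a i * c i = 0 ∧ v = fun i => c i • y}

variable {R}

lemma smul_mem_relationSpan {ι : Type*} [Fintype ι] {a c : ι → A} (hc : ∑ i, a i * c i = 0)
    (y : B) : (fun i => c i • y) ∈ relationSpan R (B := B) a :=
  Submodule.subset_span ⟨c, y, hc, rfl⟩

lemma mem_relationSpan_of_eq_sum {ι κ : Type*} [Fintype ι] [Fintype κ] {a : ι → A}
    {c : ι → κ → A} (hc : ∀ j, ∑ i, a i * c i j = 0) {y : κ → B} {b : ι → B}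
    (hb : ∀ i, b i = ∑ j, c i j • y j) : b ∈ relationSpan R a := by
  have : b = ∑ j, fun i => c i j • y j := by
    ext i
    simp [hb i, Finset.sum_apply]
  rw [this]
  exact Submodule.sum_mem _ fun j _ => smul_mem_relationSpan (hc j) (y j)

lemma exists_of_mem_relationSpan [Algebra R A] [IsScalarTower R A B] {ι : Type*} [Fintype ι] {a : ι → A}
    {b : ι → B} (hb : b ∈ relationSpan R a) :
    ∃ (m : ℕ) (c : ι → Fin m → A) (y : Fin m → B),
      (∀ i, b i = ∑ j, c i j • y j) ∧ ∀ j, ∑ i, a i * c i j = 0 := by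
  obtain ⟨m, f, g, hfg⟩ := Submodule.mem_span_set'.mp hb
  choose c y hc hg using fun j => (g j).2
  refine ⟨m, fun i j => f j • c j i, y, fun i => ?_, fun j => ?_⟩
  · rw [← hfg]
    simp [hg]
  · simp [← Finset.smul_sum, hc j]

end RelationSpan

section BaseChange

variable {R A B A' B' : Type*} [CommRing R] [Ring A] [Algebra R A]
  [AddCommGroup B] [Module R B] [Module A B]
  [Ring A'] [Algebra R A'] [AddCommGroup B'] [Module R B'] [Module A' B'] [IsScalarTower R A' B']

/-- Common denominators for finite families. -/
lemma exists_smul_eq_of_fintype [IsDomain R] {M M' : Type*} [AddCommGroup M] [Module R M]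
    [AddCommGroup M'] [Module R M'] (f : M →ₗ[R] M')
    (hf : ∀ x, ∃ r : R, r ≠ 0 ∧ ∃ m, r • x = f m) {ι : Type*} [Fintype ι] (x : ι → M') :
    ∃ r : R, r ≠ 0 ∧ ∃ m : ι → M, ∀ i, r • x i = f (m i) := by
  choose r hr m hm using fun i => hf (x i)
  have hdvd (i : ι) : r i ∣ ∏ j, r j := Finset.dvd_prod_of_mem r (Finset.mem_univ i)
  choose q hq using hdvd
  refine ⟨∏ j, r j, Finset.prod_ne_zero_iff.mpr fun i _ => hr i, fun i => q i • m i, fun i => ?_⟩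
  rw [hq i, mul_comm, mul_smul, hm, map_smul]

/-- Flatness passes to a localization of the base. -/
lemma IsFlatMod.of_localization [IsDomain R] (φ : A →ₐ[R] A') (ψ : B →ₗ[R] B')
    (hφψ : ∀ a b, ψ (a • b) = φ a • ψ b) (hψ : Function.Injective ψ)
    (hφs : ∀ x, ∃ r : R, r ≠ 0 ∧ ∃ a, r • x = φ a)
    (hψs : ∀ x, ∃ r : R, r ≠ 0 ∧ ∃ b, r • x = ψ b)
    (hu : ∀ r : R, r ≠ 0 → IsUnit (algebraMap R A' r)) (h : IsFlatMod A B) :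
    IsFlatMod A' B' := by
  intro n a' b' hab
  obtain ⟨r, hr, a, ha⟩ := exists_smul_eq_of_fintype φ.toLinearMap hφs a'
  obtain ⟨q, hq, b, hb⟩ := exists_smul_eq_of_fintype ψ hψs b'
  replace ha (i) : r • a' i = φ (a i) := ha i
  have hab' : ∑ i, a i • b i = 0 := by
    apply hψ
    have : SMulCommClass R A' B' := smulCommClass_of_isScalarTower R A' B'
    simp_rw [map_sum, hφψ, ← ha, ← hb, smul_assoc, smul_comm _ q, ← Finset.smul_sum, hab]
    simp
  obtain ⟨m, c, y, hby, hc⟩ := h n a b hab'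
  obtain ⟨u, hu'⟩ := (hu q hq).exists_right_inv
  refine ⟨m, fun i j => φ (c i j), fun j => u • ψ (y j), fun i => ?_, fun j => ?_⟩
  · rw [← (hu q hq).smul_left_cancel]
    simp_rw [Finset.smul_sum, ← mul_smul, ← mul_assoc, Algebra.commutes, mul_assoc, hu', mul_one,
      algebraMap_smul, hb, hby, map_sum, hφψ]
  · rw [← (hu r hr).mul_right_eq_zero]
    simp_rw [Finset.mul_sum, ← mul_assoc, ← Algebra.smul_def, ha, ← map_mul, ← map_sum, hc,
      map_zero]

/-- A relation that trivializes after localizing the base trivializes up to a nonzero scalar. -/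
lemma IsFlatMod.exists_smul_mem_relationSpan [IsDomain R] (φ : A →ₐ[R] A') (ψ : B →ₗ[R] B')
    (hφψ : ∀ a b, ψ (a • b) = φ a • ψ b)
    (hφ : Function.Injective φ) (hψ : Function.Injective ψ)
    (hφs : ∀ x, ∃ r : R, r ≠ 0 ∧ ∃ a, r • x = φ a)
    (hψs : ∀ x, ∃ r : R, r ≠ 0 ∧ ∃ b, r • x = ψ b) (h : IsFlatMod A' B')
    {n : ℕ} (a : Fin n → A) (b : Fin n → B) (hab : ∑ i, a i • b i = 0) :
    ∃ r : R, r ≠ 0 ∧ r • b ∈ relationSpan R a := by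
  obtain ⟨m, c', y', hb, hc'⟩ := h n (fun i => φ (a i)) (fun i => ψ (b i))
    (by simp_rw [← hφψ, ← map_sum, hab, map_zero])
  obtain ⟨p, hp, c, hc⟩ := exists_smul_eq_of_fintype φ.toLinearMap hφs
    fun x : Fin n × Fin m => c' x.1 x.2
  obtain ⟨q, hq, y, hy⟩ := exists_smul_eq_of_fintype ψ hψs y'
  replace hc (i j) : p • c' i j = φ (c (i, j)) := hc (i, j)
  refine ⟨p * q, mul_ne_zero hp hq,
    mem_relationSpan_of_eq_sum (c := fun i j => c (i, j)) (y := y) (fun j => ?_) fun i => ?_⟩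
  · apply hφ
    simp_rw [map_sum, map_mul, ← hc, mul_smul_comm, ← Finset.smul_sum, hc', smul_zero, map_zero]
  · apply hψ
    have : SMulCommClass R A' B' := smulCommClass_of_isScalarTower R A' B'
    simp_rw [map_sum, hφψ, ← hc, ← hy, Pi.smul_apply, map_smul, hb, Finset.smul_sum, mul_smul,
      smul_assoc, smul_comm _ q]

end BaseChange

section Quotient

variable {R A B A' B' : Type*} [CommRing R] [Ring A] [Algebra R A]
  [AddCommGroup B] [Module R B] [Module A B] [IsScalarTower R A B]
  [Ring A'] [Algebra R A'] [AddCommGroup B'] [Module R B'] [Module A' B']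

/-- Flatness passes to the quotient by an ideal of the base. -/
lemma IsFlatMod.of_quotient (I : Ideal R) (φ : A →ₐ[R] A') (ψ : B →ₗ[R] B')
    (hφψ : ∀ a b, ψ (a • b) = φ a • ψ b)
    (hφs : Function.Surjective φ) (hψs : Function.Surjective ψ)
    (hφ : ∀ a, φ a = 0 ↔ a ∈ (I • ⊤ : Submodule R A))
    (hψ : ∀ b, ψ b = 0 ↔ b ∈ (I • ⊤ : Submodule R B)) (h : IsFlatMod A B) :
    IsFlatMod A' B' := by
  intro n a' b' hab
  choose a ha using fun i => hφs (a' i)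
  choose b hb using fun i => hψs (b' i)
  have hmem : ∑ i, a i • b i ∈ I • Submodule.span R (Set.range (id : B → B)) := by
    rw [Set.range_id, Submodule.span_univ, ← hψ, map_sum]
    simp_rw [hφψ, ha, hb, hab]
  obtain ⟨r, hrI, hr⟩ := (Submodule.mem_ideal_smul_span_iff_exists_sum I id _).mp hmem
  let α : Fin n ⊕ r.support → A := Sum.elim a fun k => -algebraMap R A (r k)
  let β : Fin n ⊕ r.support → B := Sum.elim b fun k => k
  have hαβ : ∑ i, α i • β i = 0 := by
    simp only [α, β, Fintype.sum_sum_type, Sum.elim_inl, Sum.elim_inr, neg_smul, algebraMap_smul,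
      Finset.sum_neg_distrib, ← hr, Finsupp.sum, id]
    rw [Finset.sum_coe_sort r.support fun k => r k • k, add_neg_cancel]
  obtain ⟨m, c, y, hby, hc⟩ := h.exists_of_fintype α β hαβ
  refine ⟨m, fun i j => φ (c (Sum.inl i) j), fun j => ψ (y j), fun i => ?_, fun j => ?_⟩
  · simp_rw [← hφψ, ← map_sum, ← hby, ← hb]
    rfl
  · simp_rw [← ha, ← map_mul, ← map_sum]
    rw [hφ]
    have := hc j
    simp only [α, Fintype.sum_sum_type, Sum.elim_inl, Sum.elim_inr, neg_mul,
      Finset.sum_neg_distrib, ← sub_eq_add_neg, sub_eq_zero, ← Algebra.smul_def] at this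
    rw [this]
    exact Submodule.sum_mem _ fun k _ => Submodule.smul_mem_smul (hrI k) trivial

/-- If every element of `s I` is divisible by `t`, so is `s x` for every `x ∈ I M`. -/
lemma exists_smul_eq_smul_of_mem_smul_top {M : Type*} [AddCommGroup M] [Module R M]
    {I : Ideal R} {s t : R} (hst : ∀ r ∈ I, t ∣ s * r) {x : M}
    (hx : x ∈ (I • ⊤ : Submodule R M)) : ∃ x' : M, s • x = t • x' := by
  refine Submodule.smul_induction_on hx (fun r hr z _ => ?_) fun x y hx hy => ?_
  · obtain ⟨q, hq⟩ := hst r hr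
    exact ⟨q • z, by rw [← mul_smul, ← mul_smul, hq]⟩
  · obtain ⟨x', hx⟩ := hx
    obtain ⟨y', hy⟩ := hy
    exact ⟨x' + y', by rw [smul_add, smul_add, hx, hy]⟩

lemma IsFlatMod.smul_mem_relationSpan_of_quotient [IsDomain R]
    [Module.IsTorsionFree R A] [Module.IsTorsionFree R B]
    {I : Ideal R} (φ : A →ₐ[R] A') (ψ : B →ₗ[R] B')
    (hφψ : ∀ a b, ψ (a • b) = φ a • ψ b)
    (hφs : Function.Surjective φ) (hψs : Function.Surjective ψ)
    (hφ : ∀ a, φ a = 0 ↔ a ∈ (I • ⊤ : Submodule R A))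
    (hψ : ∀ b, ψ b = 0 ↔ b ∈ (I • ⊤ : Submodule R B)) (h : IsFlatMod A' B')
    {s t : R} (ht0 : t ≠ 0) (ht : t ∈ I) (hst : ∀ r ∈ I, t ∣ s * r)
    {n : ℕ} {a : Fin n → A} {b : Fin n → B} (hb : t • b ∈ relationSpan R a) :
    s • b ∈ relationSpan R a := by
  obtain ⟨m, c, y, hby, hc⟩ := exists_of_mem_relationSpan hb
  obtain ⟨p, d', z', hyz, hd'⟩ := h.exists_of_matrix Finset.univ (fun i j => φ (c i j))
    (fun j => ψ (y j)) fun i _ => by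
      simp_rw [← hφψ, ← map_sum, ← hby]
      exact (hψ _).mpr (Submodule.smul_mem_smul ht trivial)
  choose d hd using fun x : Fin m × Fin p => hφs (d' x.1 x.2)
  choose z hz using fun l => hψs (z' l)
  have he (i : Fin n) (l : Fin p) : ∃ e : A, s • ∑ j, c i j * d (j, l) = t • e := by
    refine exists_smul_eq_smul_of_mem_smul_top hst ((hφ _).mp ?_)
    simpa [hd] using hd' i (Finset.mem_univ i) l
  have hw (j : Fin m) : ∃ w : B, s • (y j - ∑ l, d (j, l) • z l) = t • w := by
    refine exists_smul_eq_smul_of_mem_smul_top hst ((hψ _).mp ?_)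
    simp [hφψ, hd, hz, ← hyz]
  choose e he using he
  choose w hw using hw
  have hae (l : Fin p) : ∑ i, a i * e i l = 0 := by
    refine (smul_eq_zero_iff_right ht0).mp ?_
    simp_rw [Finset.smul_sum, ← mul_smul_comm, ← he, mul_smul_comm, ← Finset.smul_sum,
      Finset.mul_sum, ← mul_assoc]
    rw [Finset.sum_comm]
    simp_rw [← Finset.sum_mul, hc]
    simp
  have hsb : s • b = (fun i => ∑ l, e i l • z l) + fun i => ∑ j, c i j • w j := by
    ext i
    have : SMulCommClass R A B := smulCommClass_of_isScalarTower R A B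
    refine smul_right_injective B ht0 ?_
    have h1 : t • ∑ l, e i l • z l = s • ∑ j, c i j • ∑ l, d (j, l) • z l := by
      simp_rw [Finset.smul_sum (r := t), ← smul_assoc, ← he, smul_assoc, ← Finset.smul_sum (r := s),
        Finset.sum_smul, Finset.smul_sum, mul_smul]
      rw [Finset.sum_comm]
    have h2 : t • ∑ j, c i j • w j = s • ∑ j, c i j • (y j - ∑ l, d (j, l) • z l) := by
      simp_rw [Finset.smul_sum (r := t), smul_comm t, ← hw, smul_comm _ s, ← Finset.smul_sum (r := s)]
    simp only [Pi.add_apply, Pi.smul_apply, smul_add]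
    rw [h1, h2, ← smul_add, ← Finset.sum_add_distrib, smul_comm t s]
    congr 1
    simpa [← smul_add] using hby i
  rw [hsb]
  exact Submodule.add_mem _ (mem_relationSpan_of_eq_sum hae fun _ => rfl)
    (mem_relationSpan_of_eq_sum hc fun _ => rfl)

end Quotient

section Dedekind

variable {R : Type*} [CommRing R] [IsDedekindDomain R]

/-- A uniformizer `t` at a nonzero maximal ideal `m` generates `m` locally. -/
lemma exists_mem_and_forall_dvd_mul {m : Ideal R} (hm : m.IsMaximal) (h0 : m ≠ ⊥) :
    ∃ t ∈ m, t ≠ 0 ∧ ∃ s ∉ m, ∀ r ∈ m, t ∣ s * r := by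
  obtain ⟨t, htm, ht2⟩ : ∃ t ∈ m, t ∉ m ^ 2 := by
    have := Ideal.pow_right_strictAnti m h0 hm.ne_top (show 1 < 2 by norm_num)
    simpa using SetLike.exists_of_lt this
  obtain ⟨I, hI⟩ := Ideal.dvd_iff_le.mpr ((Ideal.span_singleton_le_iff_mem m).mpr htm)
  have hIm : ¬ I ≤ m := fun hle => ht2 <| by
    rw [← Ideal.span_singleton_le_iff_mem, hI, pow_two]
    exact Ideal.mul_mono_right hle
  obtain ⟨s, hsI, hsm⟩ := SetLike.not_le_iff_exists.mp hIm
  refine ⟨t, htm, fun h => ht2 (h ▸ zero_mem _), s, hsm, fun r hr => ?_⟩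
  rw [← Ideal.mem_span_singleton, hI, mul_comm s]
  exact Ideal.mul_mem_mul hr hsI

/-- A nonzero proper ideal `J` of a Dedekind domain has a colon ideal `(J : x)` that is maximal. -/
lemma exists_isMaximal_forall_mem_iff_mul_mem {J : Ideal R} (h0 : J ≠ ⊥) (h1 : J ≠ ⊤) :
    ∃ m : Ideal R, m.IsMaximal ∧ m ≠ ⊥ ∧ ∃ x, ∀ r, r ∈ m ↔ r * x ∈ J := by
  have : Nontrivial (R ⧸ J) := Ideal.Quotient.nontrivial_iff.mpr h1
  obtain ⟨m, hm⟩ := associatedPrimes.nonempty R (R ⧸ J)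
  obtain ⟨hp, x, hx⟩ := isAssociatedPrime_iff.mp hm
  obtain ⟨x, rfl⟩ := Ideal.Quotient.mk_surjective x
  have hmem (r : R) : r ∈ m ↔ r * x ∈ J := by
    rw [hx, Submodule.mem_colon_singleton, Submodule.mem_bot, ← Ideal.Quotient.eq_zero_iff_mem,
      map_mul]
    rfl
  have hJm : J ≤ m := fun r hr => (hmem r).mpr (J.mul_mem_right x hr)
  have hm0 : m ≠ ⊥ := fun h => h0 (le_bot_iff.mp (h ▸ hJm))
  exact ⟨m, hp.isMaximal hm0, hm0, x, hmem⟩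

end Dedekind

section Fibers

variable (R A B k : Type*) [CommRing R] [Ring A] [Algebra R A]
  [AddCommGroup B] [Module R B] [Module A B] [IsScalarTower R A B]
  [CommRing k] [Algebra R k]

lemma fiberModule_tmul_smul_tmul (a : A) (c : k) (b : B) (d : k) :
    letI := fiberModule R A B k
    (a ⊗ₜ[R] c) • (b ⊗ₜ[R] d) = (a • b) ⊗ₜ[R] (c * d) :=
  rfl

lemma isScalarTower_fiberModule :
    letI := fiberModule R A B k
    IsScalarTower R (A ⊗[R] k) (B ⊗[R] k) := by
  let := fiberModule R A B k
  refine ⟨fun r x y => ?_⟩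
  induction x with
  | zero => simp
  | add x₁ x₂ h₁ h₂ => simp only [smul_add, add_smul, h₁, h₂]
  | tmul a c =>
    induction y with
    | zero => simp
    | add y₁ y₂ h₁ h₂ => simp only [smul_add, h₁, h₂]
    | tmul b d =>
      rw [smul_tmul', fiberModule_tmul_smul_tmul, fiberModule_tmul_smul_tmul, smul_tmul',
        smul_assoc]

variable (M : Type*) [AddCommGroup M] [Module R M]

/-- The canonical map `M → M ⊗[R] k`. -/
noncomputable def toFiber : M →ₗ[R] M ⊗[R] k := (TensorProduct.mk R M k).flip 1

lemma toFiber_apply (x : M) : toFiber R k M x = x ⊗ₜ 1 := rfl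

lemma toFiber_smul (a : A) (b : B) :
    letI := fiberModule R A B k
    toFiber R k B (a • b) =
      (Algebra.TensorProduct.includeLeft : A →ₐ[R] A ⊗[R] k) a • toFiber R k B b := by
  let := fiberModule R A B k
  simp [toFiber_apply, fiberModule_tmul_smul_tmul]

lemma toFiber_injective [Module.Flat R M] (hk : Function.Injective (algebraMap R k)) :
    Function.Injective (toFiber R k M) := by
  have h := Module.Flat.lTensor_preserves_injective_linearMap (M := M) (Algebra.linearMap R k) hk
  have : toFiber R k M = (Algebra.linearMap R k).lTensor M ∘ₗ (TensorProduct.rid R M).symm := by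
    ext x
    simp [toFiber_apply]
  rw [this]
  exact h.comp (TensorProduct.rid R M).symm.injective

lemma exists_smul_eq_toFiber [IsDomain R] (x : M ⊗[R] FractionRing R) :
    ∃ r : R, r ≠ 0 ∧ ∃ y, r • x = toFiber R (FractionRing R) M y := by
  induction x with
  | zero => exact ⟨1, one_ne_zero, 0, by simp⟩
  | tmul y c =>
    obtain ⟨p, q, hq, rfl⟩ := IsFractionRing.div_surjective (A := R) c
    have hq0 := nonZeroDivisors.ne_zero hq
    refine ⟨q, hq0, p • y, ?_⟩
    have : algebraMap R (FractionRing R) q ≠ 0 := by simpa using hq0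
    rw [toFiber_apply, smul_tmul, ← tmul_smul, Algebra.smul_def, Algebra.smul_def, mul_one,
      mul_div_cancel₀ _ this]
  | add x₁ x₂ h₁ h₂ =>
    obtain ⟨r₁, hr₁, y₁, h₁⟩ := h₁
    obtain ⟨r₂, hr₂, y₂, h₂⟩ := h₂
    refine ⟨r₁ * r₂, mul_ne_zero hr₁ hr₂, r₂ • y₁ + r₁ • y₂, ?_⟩
    rw [smul_add, map_add, map_smul, map_smul, ← h₁, ← h₂, ← mul_smul, ← mul_smul, mul_comm r₂]

lemma toFiber_quotient_surjective (I : Ideal R) : Function.Surjective (toFiber R (R ⧸ I) M) := by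
  intro x
  induction x with
  | zero => exact ⟨0, map_zero _⟩
  | tmul y c =>
    obtain ⟨r, rfl⟩ := Ideal.Quotient.mk_surjective c
    refine ⟨r • y, ?_⟩
    rw [toFiber_apply, smul_tmul, Algebra.smul_def, mul_one]
    rfl
  | add x₁ x₂ h₁ h₂ =>
    obtain ⟨y₁, rfl⟩ := h₁
    obtain ⟨y₂, rfl⟩ := h₂
    exact ⟨y₁ + y₂, map_add _ _ _⟩

lemma toFiber_quotient_eq_zero_iff (I : Ideal R) (x : M) :
    toFiber R (R ⧸ I) M x = 0 ↔ x ∈ (I • ⊤ : Submodule R M) := by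
  rw [← (tensorQuotEquivQuotSMul M I).map_eq_zero_iff, toFiber_apply, tensorQuotEquivQuotSMul]
  simp

lemma isUnit_algebraMap_tensorProduct_fractionRing [IsDomain R] {r : R} (hr : r ≠ 0) :
    IsUnit (algebraMap R (A ⊗[R] FractionRing R) r) := by
  rw [← (Algebra.TensorProduct.includeRight : FractionRing R →ₐ[R] A ⊗[R] FractionRing R).commutes]
  exact (IsUnit.mk0 _ (by simpa using hr)).map _

end Fibers

/-- **Lemma (flatness criterion over a Dedekind domain).**
Let `R` be a Dedekind domain with fraction field `K`, `A` an associative unital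
`R`-algebra and `B` a left `A`-module, with both `A` and `B` flat over `R`.
Then `B` is flat as a left `A`-module iff `B ⊗[R] k` is flat as a left
`(A ⊗[R] k)`-module for `k = K` and for `k = R/m`, `m` any maximal ideal of `R`. -/
theorem flat_iff_flat_fibers
    (R : Type*) [CommRing R] [IsDomain R] [IsDedekindDomain R]
    (A : Type*) [Ring A] [Algebra R A]
    (B : Type*) [AddCommGroup B] [Module R B] [Module A B] [IsScalarTower R A B]
    [Module.Flat R A] [Module.Flat R B] :
    IsFlatMod A B ↔
      ((letI := fiberModule R A B (FractionRing R);
        IsFlatMod (A ⊗[R] FractionRing R) (B ⊗[R] FractionRing R)) ∧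
        ∀ m : Ideal R, m.IsMaximal →
          letI := fiberModule R A B (R ⧸ m);
          IsFlatMod (A ⊗[R] (R ⧸ m)) (B ⊗[R] (R ⧸ m))) := by
  have hinj := IsFractionRing.injective R (FractionRing R)
  constructor
  · intro h
    constructor
    · let := fiberModule R A B (FractionRing R)
      have := isScalarTower_fiberModule R A B (FractionRing R)
      exact h.of_localization Algebra.TensorProduct.includeLeft (toFiber R (FractionRing R) B)
        (toFiber_smul R A B _) (toFiber_injective R _ B hinj) (exists_smul_eq_toFiber R A)
        (exists_smul_eq_toFiber R B)
        fun r hr => isUnit_algebraMap_tensorProduct_fractionRing R A hr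
    · intro m _
      let := fiberModule R A B (R ⧸ m)
      exact h.of_quotient m Algebra.TensorProduct.includeLeft (toFiber R (R ⧸ m) B)
        (toFiber_smul R A B _) (toFiber_quotient_surjective R A m)
        (toFiber_quotient_surjective R B m) (toFiber_quotient_eq_zero_iff R A m)
        (toFiber_quotient_eq_zero_iff R B m)
  · rintro ⟨hK, hm⟩ n a b hab
    refine exists_of_mem_relationSpan (R := R) ?_
    obtain ⟨r, hr, hrb⟩ : ∃ r : R, r ≠ 0 ∧ r • b ∈ relationSpan R a := by
      let := fiberModule R A B (FractionRing R)
      have := isScalarTower_fiberModule R A B (FractionRing R)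
      exact hK.exists_smul_mem_relationSpan Algebra.TensorProduct.includeLeft
        (toFiber R (FractionRing R) B) (toFiber_smul R A B _) (toFiber_injective R _ A hinj)
        (toFiber_injective R _ B hinj) (exists_smul_eq_toFiber R A)
        (exists_smul_eq_toFiber R B) a b hab
    let J : Ideal R := (relationSpan R a).comap (LinearMap.toSpanSingleton R (Fin n → B) b)
    have hJ (r : R) : r ∈ J ↔ r • b ∈ relationSpan R a := Iff.rfl
    by_contra hb
    have hJ0 : J ≠ ⊥ := fun h => hr <| by
      rw [← Ideal.mem_bot, ← h]
      exact hrb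
    have hJ1 : J ≠ ⊤ := fun h => hb <| by
      have := (hJ 1).mp (h ▸ trivial)
      rwa [one_smul] at this
    obtain ⟨m, hmax, hm0, x, hx⟩ := exists_isMaximal_forall_mem_iff_mul_mem hJ0 hJ1
    obtain ⟨t, htm, ht0, s, hsm, hst⟩ := exists_mem_and_forall_dvd_mul hmax hm0
    refine hsm ((hx s).mpr ?_)
    rw [hJ, mul_smul]
    have htx : t • x • b ∈ relationSpan R a := by
      rw [← mul_smul, ← hJ]
      exact (hx t).mp htm
    let := fiberModule R A B (R ⧸ m)
    exact (hm m hmax).smul_mem_relationSpan_of_quotient Algebra.TensorProduct.includeLeft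
      (toFiber R (R ⧸ m) B) (toFiber_smul R A B _) (toFiber_quotient_surjective R A m)
      (toFiber_quotient_surjective R B m) (toFiber_quotient_eq_zero_iff R A m)
      (toFiber_quotient_eq_zero_iff R B m) ht0 htm hst htx
end

section
/- Let R be a Dedekind domain and H a Hopf algebra over R which is projective as an R-module and possesses a non-zero left integral. Then the R-module I^l_H of left integrals on H is a projective R-module of rank one (i.e. projective, and I^l_H ⊗_R K is one-dimensional over the fraction field K of R). -/
open TensorProduct

section Integrals

variable (R H : Type*) [CommRing R] [Ring H] [HopfAlgebra R H]

/-- A left integral on the Hopf algebra `H`: an `R`-linear map `φ : H → R` with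
`∑ h₁ φ(h₂) = φ(h) • 1` for all `h`. -/
def IsLeftIntegral (φ : H →ₗ[R] R) : Prop :=
  ∀ h : H, (TensorProduct.rid R H) ((LinearMap.lTensor H φ) (Coalgebra.comul h)) =
    φ h • (1 : H)

/-- A right integral on the Hopf algebra `H`: an `R`-linear map `φ : H → R` with
`∑ φ(h₁) h₂ = φ(h) • 1` for all `h`. -/
def IsRightIntegral (φ : H →ₗ[R] R) : Prop :=
  ∀ h : H, (TensorProduct.lid R H) ((LinearMap.rTensor H φ) (Coalgebra.comul h)) =
    φ h • (1 : H)

/-- The `R`-module `I^l_H` of left integrals on `H`. -/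
noncomputable def leftIntegrals : Submodule R (H →ₗ[R] R) where
  carrier := {φ | IsLeftIntegral R H φ}
  add_mem' := fun {φ} {ψ} hφ hψ h => by
    simp only [LinearMap.lTensor_add, LinearMap.add_apply, map_add, hφ h, hψ h,
      LinearMap.add_apply, add_smul]
  zero_mem' := fun h => by
    simp [LinearMap.lTensor_zero]
  smul_mem' := fun r φ hφ h => by
    simp only [LinearMap.lTensor_smul, LinearMap.smul_apply, map_smul, hφ h, smul_assoc]
end Integrals

open Coalgebra HopfAlgebra WithConv

section Convolution

variable {R C A B : Type*} [CommRing R] [AddCommGroup C] [Module R C] [Coalgebra R C]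
  [Ring A] [Algebra R A] [Ring B] [Algebra R B]

/-- Postcomposition with an algebra homomorphism, as a homomorphism of convolution monoids. -/
noncomputable def AlgHom.convPush (h : A →ₐ[R] B) :
    WithConv (C →ₗ[R] A) →* WithConv (C →ₗ[R] B) where
  toFun f := toConv (h.toLinearMap ∘ₗ f.ofConv)
  map_one' := by
    ext c
    simp
  map_mul' f g := by
    apply WithConv.ofConv_injective
    exact LinearMap.algHom_comp_convMul_distrib h f g

@[simp] lemma AlgHom.convPush_apply (h : A →ₐ[R] B) (f : WithConv (C →ₗ[R] A)) (c : C) :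
    h.convPush f c = h (f c) := rfl

end Convolution

section Antipode

variable (R H : Type*) [CommRing R] [Ring H] [HopfAlgebra R H]

/-- The antipode as an element of the convolution ring. -/
noncomputable abbrev convAntipode : WithConv (H →ₗ[R] H) := toConv (antipode R)

/-- The identity as an element of the convolution ring. -/
noncomputable abbrev convId : WithConv (H →ₗ[R] H) := toConv LinearMap.id

/-- The square of the antipode as an algebra endomorphism. -/
noncomputable def antipodeSq : H →ₐ[R] H :=
  .ofLinearMap (antipode R ∘ₗ antipode R) (by simp)
    (fun x y => by simp [antipode_mul_antidistrib])

variable {R H}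

@[simp] lemma antipodeSq_apply (x : H) : antipodeSq R H x = antipode R (antipode R x) := rfl

/-- The embedding of `H` in the left tensor factor. -/
noncomputable abbrev inclL : H →ₐ[R] H ⊗[R] H := Algebra.TensorProduct.includeLeft

/-- The embedding of `H` in the right tensor factor. -/
noncomputable abbrev inclR : H →ₐ[R] H ⊗[R] H := Algebra.TensorProduct.includeRight

lemma AlgHom.convPush_antipode_mul_id {B : Type*} [Ring B] [Algebra R B] (h : H →ₐ[R] B) :
    h.convPush (convAntipode R H) * h.convPush (convId R H) = 1 := by
  rw [← map_mul, LinearMap.antipode_mul_id, map_one]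

lemma AlgHom.convPush_id_mul_antipode {B : Type*} [Ring B] [Algebra R B] (h : H →ₐ[R] B) :
    h.convPush (convId R H) * h.convPush (convAntipode R H) = 1 := by
  rw [← map_mul, LinearMap.id_mul_antipode, map_one]

lemma comul_eq_convMul : (Bialgebra.comulAlgHom R H).convPush (convId R H) =
    inclL.convPush (convId R H) * inclR.convPush (convId R H) := by
  ext c
  have : ∀ z : H ⊗[R] H, z = LinearMap.mul' R (H ⊗[R] H)
      (TensorProduct.map (inclL (R := R) (H := H)).toLinearMap inclR.toLinearMap z) := by
    intro z
    induction z with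
    | zero => simp
    | tmul x y => simp
    | add x y hx hy => rw [map_add, map_add, ← hx, ← hy]
  exact this _

lemma comul_antipode_eq_convMul : (Bialgebra.comulAlgHom R H).convPush (convAntipode R H) =
    inclR.convPush (convAntipode R H) * inclL.convPush (convAntipode R H) := by
  have h := (Bialgebra.comulAlgHom R H).convPush_antipode_mul_id
  rw [comul_eq_convMul] at h
  refine left_inv_eq_right_inv h ?_
  rw [mul_assoc, ← mul_assoc (inclR.convPush _), AlgHom.convPush_id_mul_antipode, one_mul,
    AlgHom.convPush_id_mul_antipode]

lemma comul_antipode (x : H) : comul (R := R) (antipode R x) =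
    TensorProduct.comm R H H (TensorProduct.map (antipode R) (antipode R) (comul x)) := by
  have h := congr($(comul_antipode_eq_convMul (R := R)) x)
  refine h.trans ?_
  have : ∀ z : H ⊗[R] H, LinearMap.mul' R (H ⊗[R] H)
      (TensorProduct.map (inclR.toLinearMap ∘ₗ antipode R) (inclL.toLinearMap ∘ₗ antipode R) z) =
      TensorProduct.comm R H H (TensorProduct.map (antipode R) (antipode R) z) := by
    intro z
    induction z with
    | zero => simp
    | tmul x y => simp
    | add x y hx hy => simp only [map_add, hx, hy]
  exact this _

lemma comul_antipodeSq_eq_convMul :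
    (Bialgebra.comulAlgHom R H).convPush ((antipodeSq R H).convPush (convId R H)) =
    inclL.convPush ((antipodeSq R H).convPush (convId R H)) *
      inclR.convPush ((antipodeSq R H).convPush (convId R H)) := by
  ext c
  have : ∀ z : H ⊗[R] H, TensorProduct.comm R H H (TensorProduct.map (antipode R) (antipode R)
        (TensorProduct.comm R H H (TensorProduct.map (antipode R) (antipode R) z))) =
      LinearMap.mul' R (H ⊗[R] H)
        (TensorProduct.map (inclL.toLinearMap ∘ₗ (antipodeSq R H).toLinearMap)
          (inclR.toLinearMap ∘ₗ (antipodeSq R H).toLinearMap) z) := by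
    intro z
    induction z with
    | zero => simp
    | tmul x y => simp
    | add x y hx hy => simp only [map_add, hx, hy]
  refine Eq.trans ?_ (this _)
  change comul (R := R) (antipode R (antipode R c)) = _
  rw [comul_antipode, comul_antipode]

lemma comul_antipode_mul_id :
    (Bialgebra.comulAlgHom R H).convPush (convAntipode R H) * inclL.convPush (convId R H) =
      inclR.convPush (convAntipode R H) := by
  rw [comul_antipode_eq_convMul, mul_assoc, AlgHom.convPush_antipode_mul_id, mul_one]

lemma antipode_mul_comul : inclL.convPush (convAntipode R H) *
    (Bialgebra.comulAlgHom R H).convPush (convId R H) = inclR.convPush (convId R H) := by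
  rw [comul_eq_convMul, ← mul_assoc, AlgHom.convPush_antipode_mul_id, one_mul]

lemma comul_antipodeCube_mul :
    (Bialgebra.comulAlgHom R H).convPush ((antipodeSq R H).convPush (convAntipode R H)) *
      inclL.convPush ((antipodeSq R H).convPush (convId R H)) =
      inclR.convPush ((antipodeSq R H).convPush (convAntipode R H)) := by
  have h : (Bialgebra.comulAlgHom R H).convPush ((antipodeSq R H).convPush (convAntipode R H)) *
      (Bialgebra.comulAlgHom R H).convPush ((antipodeSq R H).convPush (convId R H)) = 1 := by
    rw [← map_mul, AlgHom.convPush_antipode_mul_id, map_one]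
  rw [comul_antipodeSq_eq_convMul, ← mul_assoc] at h
  refine left_inv_eq_right_inv h ?_
  rw [← map_mul, AlgHom.convPush_id_mul_antipode, map_one]

end Antipode

section IntegralIdentities

variable {R H : Type*} [CommRing R] [Ring H] [HopfAlgebra R H]

/-- Apply a functional to the right tensor factor. -/
noncomputable def sliceRight (φ : H →ₗ[R] R) : H ⊗[R] H →ₗ[R] H :=
  (TensorProduct.rid R H).toLinearMap ∘ₗ φ.lTensor H

@[simp] lemma sliceRight_tmul (φ : H →ₗ[R] R) (x y : H) :
    sliceRight φ (x ⊗ₜ y) = φ y • x := by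
  simp [sliceRight]

lemma sliceRight_left_mul (φ : H →ₗ[R] R) (h : H) (z : H ⊗[R] H) :
    sliceRight φ (inclL (R := R) h * z) = h * sliceRight φ z := by
  induction z with
  | zero => simp
  | tmul x y => simp
  | add x y hx hy => simp only [map_add, mul_add, hx, hy]

lemma sliceRight_mul_left (φ : H →ₗ[R] R) (h : H) (z : H ⊗[R] H) :
    sliceRight φ (z * inclL (R := R) h) = sliceRight φ z * h := by
  induction z with
  | zero => simp
  | tmul x y => simp
  | add x y hx hy => simp only [map_add, add_mul, hx, hy]

/-- The map `x ↦ φ(x) • 1` as an element of the convolution ring. -/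
noncomputable def scalarConv (φ : H →ₗ[R] R) : WithConv (H →ₗ[R] H) :=
  toConv (Algebra.linearMap R H ∘ₗ φ)

@[simp] lemma scalarConv_apply (φ : H →ₗ[R] R) (x : H) :
    scalarConv φ x = algebraMap R H (φ x) := rfl

variable {φ : H →ₗ[R] R}

lemma IsLeftIntegral.sliceRight_comul (hφ : IsLeftIntegral R H φ) (x : H) :
    sliceRight φ (comul x) = algebraMap R H (φ x) := by
  rw [Algebra.algebraMap_eq_smul_one]
  exact hφ x

/-- `∑ b₁ φ(a b₂) = ∑ S(a₁) φ(a₂ b)`. -/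
lemma IsLeftIntegral.sliceRight_inclR_mul_comul (hφ : IsLeftIntegral R H φ) (a b : H) :
    sliceRight φ (inclR (R := R) a * comul b) =
      (convAntipode R H * scalarConv (φ ∘ₗ LinearMap.mulRight R b)) a := by
  have h := congr($(antipode_mul_comul (R := R) (H := H)) a)
  change _ = inclR (R := R) a at h
  rw [← h, (ℛ R a).convMul_apply, (ℛ R a).convMul_apply, Finset.sum_mul, map_sum]
  refine Finset.sum_congr rfl fun i _ => ?_
  simp only [AlgHom.convPush_apply, mul_assoc, scalarConv_apply]
  rw [sliceRight_left_mul]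
  congr 1
  change sliceRight φ (comul _ * comul b) = _
  rw [← Bialgebra.comul_mul, hφ.sliceRight_comul]
  simp

/-- `∑ a₁ φ(a₂ S(b)) = ∑ φ(a S(b₁)) b₂`. -/
lemma IsLeftIntegral.sliceRight_comul_mul_inclR_antipode (hφ : IsLeftIntegral R H φ) (a b : H) :
    sliceRight φ (comul a * inclR (R := R) (antipode R b)) =
      (scalarConv (φ ∘ₗ LinearMap.mulLeft R a ∘ₗ antipode R) * convId R H) b := by
  have h := congr($(comul_antipode_mul_id (R := R) (H := H)) b)
  change _ = inclR (R := R) (antipode R b) at h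
  rw [← h, (ℛ R b).convMul_apply, (ℛ R b).convMul_apply, Finset.mul_sum, map_sum]
  refine Finset.sum_congr rfl fun i _ => ?_
  simp only [AlgHom.convPush_apply, ← mul_assoc, scalarConv_apply]
  rw [sliceRight_mul_left]
  congr 1
  change sliceRight φ (comul a * comul (antipode R _)) = _
  rw [← Bialgebra.comul_mul, hφ.sliceRight_comul]
  simp

lemma scalarConv_mul_id_apply (f : H →ₗ[R] R) (b : H) :
    (scalarConv f * convId R H) b = TensorProduct.lid R H (f.rTensor H (comul b)) := by
  rw [(ℛ R b).convMul_apply, ← (ℛ R b).eq]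
  simp [Algebra.smul_def]

lemma antipode_mul_scalarConv_apply_antipode (f : H →ₗ[R] R) (y : H) :
    (convAntipode R H * scalarConv f) (antipode R y) =
      antipode R (antipode R (TensorProduct.lid R H ((f ∘ₗ antipode R).rTensor H (comul y)))) := by
  rw [LinearMap.convMul_apply, comul_antipode, ← (ℛ R y).eq]
  simp only [map_sum, TensorProduct.map_tmul, TensorProduct.comm_tmul, LinearMap.mul'_apply,
    LinearMap.rTensor_tmul, TensorProduct.lid_tmul, map_smul]
  refine Finset.sum_congr rfl fun i _ => ?_
  rw [Algebra.smul_def, Algebra.commutes]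
  rfl

lemma IsLeftIntegral.isRightIntegral_comp_antipode (hφ : IsLeftIntegral R H φ) :
    IsRightIntegral R H (φ ∘ₗ antipode R) := by
  intro b
  have h := hφ.sliceRight_comul_mul_inclR_antipode 1 b
  rw [scalarConv_mul_id_apply, LinearMap.mulLeft_one, LinearMap.id_comp] at h
  rw [← h]
  simp

lemma IsLeftIntegral.sliceRight_inclR_antipode_mul_comul (hφ : IsLeftIntegral R H φ) (y b : H) :
    sliceRight φ (inclR (R := R) (antipode R y) * comul b) =
      antipode R (antipode R (TensorProduct.lid R H
        ((φ ∘ₗ LinearMap.mulRight R b ∘ₗ antipode R).rTensor H (comul y)))) := by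
  rw [hφ.sliceRight_inclR_mul_comul, antipode_mul_scalarConv_apply_antipode]
  rfl

/-- For a right integral `χ` and `x : H` there is `y : H` such that `θ(S(x)) χ = θ(S(y) · _)` for
every left integral `θ`. -/
lemma IsRightIntegral.exists_apply_antipode_mul {χ : H →ₗ[R] R}
    (hχ : IsRightIntegral R H χ) (x : H) :
    ∃ y : H, ∀ θ : H →ₗ[R] R, IsLeftIntegral R H θ → ∀ b : H,
      θ (antipode R x) * χ b = θ (antipode R y * b) := by
  refine ⟨TensorProduct.rid R H ((χ ∘ₗ antipode R ∘ₗ antipode R).lTensor H (comul x)),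
    fun θ hθ b => ?_⟩
  have h := congr(χ $(hθ.sliceRight_inclR_antipode_mul_comul x b))
  have hl : ∀ (a : H) (z : H ⊗[R] H), χ (sliceRight θ (inclR (R := R) a * z)) =
      θ (a * TensorProduct.lid R H (χ.rTensor H z)) := by
    intro a z
    induction z with
    | zero => simp
    | tmul x y => simp [mul_comm]
    | add x y hx hy => simp only [map_add, mul_add, hx, hy]
  have hr : ∀ z : H ⊗[R] H, χ (antipode R (antipode R (TensorProduct.lid R H
      ((θ ∘ₗ LinearMap.mulRight R b ∘ₗ antipode R).rTensor H z)))) =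
      θ (antipode R
        (TensorProduct.rid R H ((χ ∘ₗ antipode R ∘ₗ antipode R).lTensor H z)) * b) := by
    intro z
    induction z with
    | zero => simp
    | tmul x y => simp [mul_comm]
    | add x y hx hy => simp only [map_add, add_mul, hx, hy]
  rw [hl, hr, hχ b] at h
  rw [← h]
  simp [mul_comm]

end IntegralIdentities

section Faithfulness

variable {R H : Type*} [CommRing R]

/-- For a projective module `N`, an element of `M* ⊗ N` is determined by the map `M → N` it
induces. -/
lemma Module.Dual.tensor_eq_zero_of_forall_eval {M N : Type*} [AddCommGroup M] [Module R M]
    [AddCommGroup N] [Module R N] [Module.Projective R N] (y : (M →ₗ[R] R) ⊗[R] N)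
    (h : ∀ a : M, TensorProduct.lid R N ((LinearMap.applyₗ a).rTensor N y) = 0) : y = 0 := by
  obtain ⟨s, hs⟩ := Module.projective_def'.mp (inferInstance : Module.Projective R N)
  have hinj : Function.Injective (s.lTensor (M →ₗ[R] R)) := by
    refine Function.LeftInverse.injective
      (g := (Finsupp.linearCombination R (id : N → N)).lTensor (M →ₗ[R] R)) fun z => ?_
    rw [← LinearMap.lTensor_comp_apply, hs, LinearMap.lTensor_id, LinearMap.id_apply]
  apply hinj
  rw [map_zero]
  classical
  apply (TensorProduct.finsuppScalarRight R R (M →ₗ[R] R) N).injective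
  rw [map_zero]
  ext i a
  have key : ∀ z : (M →ₗ[R] R) ⊗[R] N,
      TensorProduct.finsuppScalarRight R R (M →ₗ[R] R) N (s.lTensor (M →ₗ[R] R) z) i a =
      s (TensorProduct.lid R N ((LinearMap.applyₗ a).rTensor N z)) i := by
    intro z
    induction z with
    | zero => simp
    | tmul x y => simp [mul_comm]
    | add x y hx hy => simp only [map_add, Finsupp.add_apply, LinearMap.add_apply, hx, hy]
  rw [key, h a]
  simp

lemma smul_eq_zero_of_rTensor_comul_eq_zero {C Q : Type*} [AddCommGroup C] [Module R C]
    [Coalgebra R C] [AddCommGroup Q] [Module R Q] (P : C →ₗ[R] Q) (B : Q ⊗[R] C →ₗ[R] R) (r : R)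
    (hB : ∀ c : C, B (P.rTensor C (comul c)) = counit (R := R) c * r)
    {b : C} (hb : P.rTensor C (comul b) = 0) : r • b = 0 := by
  have key : ∀ z : C ⊗[R] (C ⊗[R] C),
      (B ∘ₗ P.rTensor C).rTensor C ((TensorProduct.assoc R C C C).symm z) =
      B.rTensor C ((TensorProduct.assoc R Q C C).symm (P.rTensor (C ⊗[R] C) z)) := by
    intro z
    have : (B ∘ₗ P.rTensor C).rTensor C ∘ₗ (TensorProduct.assoc R C C C).symm.toLinearMap =
        B.rTensor C ∘ₗ (TensorProduct.assoc R Q C C).symm.toLinearMap ∘ₗ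
          P.rTensor (C ⊗[R] C) := by
      ext; simp
    exact congr($this z)
  have h1 := key (comul.lTensor C (comul b))
  rw [Coalgebra.coassoc_symm_apply, ← LinearMap.rTensor_comp_apply] at h1
  have h2 : (B ∘ₗ P.rTensor C) ∘ₗ comul = r • counit (R := R) (A := C) := by
    ext c
    simp [hB, mul_comm]
  have h3 : ∀ z : C ⊗[R] C, P.rTensor (C ⊗[R] C) (comul.lTensor C z) =
      comul.lTensor Q (P.rTensor C z) := fun z => by
    simp only [← LinearMap.comp_apply, LinearMap.rTensor_comp_lTensor,
      LinearMap.lTensor_comp_rTensor]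
  rw [h2, h3, hb, map_zero, map_zero, map_zero, LinearMap.rTensor_smul, LinearMap.smul_apply,
    Coalgebra.rTensor_counit_comul] at h1
  simpa using congr(TensorProduct.lid R C $h1)

variable [IsDomain R] [Ring H] [HopfAlgebra R H] [Module.Projective R H] {φ : H →ₗ[R] R}

/-- A nonzero left integral is faithful on the right translates by `S(b)`. -/
lemma IsLeftIntegral.eq_zero_of_mul_antipode (hφ : IsLeftIntegral R H φ) (h0 : φ ≠ 0) {b : H}
    (hb : ∀ a : H, φ (a * antipode R b) = 0) : b = 0 := by
  obtain ⟨a, ha⟩ := DFunLike.ne_iff.mp h0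
  let P : H →ₗ[R] (H →ₗ[R] R) := ((LinearMap.mul R H).flip.compr₂ φ) ∘ₗ antipode R
  have hP : P.rTensor H (comul b) = 0 := by
    refine Module.Dual.tensor_eq_zero_of_forall_eval _ fun a => ?_
    have h := hφ.sliceRight_comul_mul_inclR_antipode a b
    have hz : ∀ z : H ⊗[R] H, sliceRight φ (z * inclR (R := R) (antipode R b)) = 0 := by
      intro z
      induction z with
      | zero => simp
      | tmul x y => simp [hb]
      | add x y hx hy => simp only [add_mul, map_add, hx, hy, add_zero]
    rw [hz, scalarConv_mul_id_apply] at h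
    rw [← LinearMap.rTensor_comp_apply]
    exact h.symm
  have := smul_eq_zero_of_rTensor_comul_eq_zero P
    (TensorProduct.lift (LinearMap.lcomp R R
      (LinearMap.mulLeft R a ∘ₗ (antipodeSq R H).toLinearMap))) (φ a) (fun c => ?_) hP
  · exact (smul_eq_zero.mp this).resolve_left ha
  · have hz : ∀ z : H ⊗[R] H, TensorProduct.lift (LinearMap.lcomp R R
        (LinearMap.mulLeft R a ∘ₗ (antipodeSq R H).toLinearMap)) (P.rTensor H z) =
        φ (a * antipode R (LinearMap.mul' R H ((antipode R).lTensor H z))) := by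
      intro z
      induction z with
      | zero => simp
      | tmul x y => simp [P, antipode_mul_antidistrib, mul_assoc]
      | add x y hx hy => simp only [mul_add, map_add, hx, hy]
    rw [hz, mul_antipode_lTensor_comul_apply]
    simp [Algebra.algebraMap_eq_smul_one]

lemma IsLeftIntegral.antipode_injective (hφ : IsLeftIntegral R H φ) (h0 : φ ≠ 0) :
    Function.Injective (antipode R (A := H)) := by
  rw [injective_iff_map_eq_zero]
  intro b hb
  exact hφ.eq_zero_of_mul_antipode h0 fun a => by simp [hb]

/-- A nonzero left integral is faithful on the left translates by `S(y)`. -/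
lemma IsLeftIntegral.eq_zero_of_antipode_mul (hφ : IsLeftIntegral R H φ) (h0 : φ ≠ 0) {y : H}
    (hy : ∀ b : H, φ (antipode R y * b) = 0) : y = 0 := by
  obtain ⟨a, ha⟩ := DFunLike.ne_iff.mp h0
  let P : H →ₗ[R] (H →ₗ[R] R) := ((LinearMap.mul R H).compr₂ φ) ∘ₗ antipode R
  have hP : P.rTensor H (comul y) = 0 := by
    refine Module.Dual.tensor_eq_zero_of_forall_eval _ fun b => ?_
    have h := hφ.sliceRight_inclR_antipode_mul_comul y b
    have hz : ∀ z : H ⊗[R] H, sliceRight φ (inclR (R := R) (antipode R y) * z) = 0 := by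
      intro z
      induction z with
      | zero => simp
      | tmul x y => simp [hy]
      | add x y hx hy => simp only [mul_add, map_add, hx, hy, add_zero]
    rw [hz] at h
    have hS := hφ.antipode_injective h0
    rw [← LinearMap.rTensor_comp_apply]
    apply hS
    apply hS
    rw [map_zero, map_zero]
    exact h.symm
  have := smul_eq_zero_of_rTensor_comul_eq_zero P
    (TensorProduct.lift (LinearMap.lcomp R R (LinearMap.mulRight R a))) (φ a) (fun c => ?_) hP
  · exact (smul_eq_zero.mp this).resolve_left ha
  · have hz : ∀ z : H ⊗[R] H, TensorProduct.lift (LinearMap.lcomp R R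
        (LinearMap.mulRight R a)) (P.rTensor H z) =
        φ (LinearMap.mul' R H ((antipode R).rTensor H z) * a) := by
      intro z
      induction z with
      | zero => simp
      | tmul x y => simp [P, mul_assoc]
      | add x y hx hy => simp only [add_mul, map_add, hx, hy]
    rw [hz, mul_antipode_rTensor_comul_apply]
    simp [Algebra.algebraMap_eq_smul_one]

/-- If some left integral does not vanish at `S(x)`, then no nonzero left integral does. -/
lemma IsLeftIntegral.eq_zero_of_apply_antipode_eq_zero {θ : H →ₗ[R] R} (hθ : IsLeftIntegral R H θ)
    (hφ : IsLeftIntegral R H φ) {x : H} (hx : φ (antipode R x) ≠ 0)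
    (h : θ (antipode R x) = 0) : θ = 0 := by
  by_contra h0
  obtain ⟨y, hy⟩ := hφ.isRightIntegral_comp_antipode.exists_apply_antipode_mul x
  have hy0 : y = 0 := hθ.eq_zero_of_antipode_mul h0 fun b => by rw [← hy θ hθ, h, zero_mul]
  have := hy φ hφ x
  rw [hy0] at this
  simp [hx] at this

end Faithfulness

section Existence

variable {R H : Type*} [CommRing R] [Ring H] [HopfAlgebra R H]

/-- The operator `a ↦ ∑ u₂ a S³(u₁)` on `H`. -/
noncomputable def adjointOp : WithConv (H →ₗ[R] Module.End R H) :=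
  toConv ((LinearMap.mul R H).flip ∘ₗ antipode R ∘ₗ (antipodeSq R H).toLinearMap) *
    toConv (LinearMap.mul R H)

lemma adjointOp_apply (u a : H) : adjointOp (R := R) u a =
    ∑ i ∈ (ℛ R u).index, (ℛ R u).right i * a *
      antipode R (antipode R (antipode R ((ℛ R u).left i))) := by
  rw [adjointOp, (ℛ R u).convMul_apply]
  simp [LinearMap.sum_apply]

variable {φ : H →ₗ[R] R}

/-- `∑ a₁ φ(u a₂ S³(x)) = ∑ S(u₁) φ(u₂ a S³(x₁)) S²(x₂)`. -/
lemma IsLeftIntegral.sliceRight_inclR_mul_comul_mul_inclR (hφ : IsLeftIntegral R H φ)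
    (u a x : H) :
    sliceRight φ (inclR (R := R) u * comul a *
        inclR (R := R) (antipode R (antipode R (antipode R x)))) =
      ∑ i ∈ (ℛ R x).index, ∑ j ∈ (ℛ R u).index,
        φ ((ℛ R u).right j * a * antipode R (antipode R (antipode R ((ℛ R x).left i)))) •
          (antipode R ((ℛ R u).left j) * antipode R (antipode R ((ℛ R x).right i))) := by
  have h := congr($(comul_antipodeCube_mul (R := R) (H := H)) x)
  change _ = inclR (R := R) (antipode R (antipode R (antipode R x))) at h
  rw [← h, (ℛ R x).convMul_apply, Finset.mul_sum, map_sum]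
  refine Finset.sum_congr rfl fun i _ => ?_
  rw [← mul_assoc]
  change sliceRight φ (_ * inclL (R := R) (antipode R (antipode R ((ℛ R x).right i)))) = _
  rw [sliceRight_mul_left, mul_assoc]
  change sliceRight φ (_ * (comul a *
    comul (antipode R (antipode R (antipode R ((ℛ R x).left i)))))) * _ = _
  rw [← Bialgebra.comul_mul, hφ.sliceRight_inclR_mul_comul, (ℛ R u).convMul_apply, Finset.sum_mul]
  refine Finset.sum_congr rfl fun j _ => ?_
  simp only [scalarConv_apply, LinearMap.comp_apply, LinearMap.mulRight_apply, mul_assoc]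
  rw [← mul_assoc, ← Algebra.commutes, mul_assoc, Algebra.smul_def]

/-- Every `u : H` yields a left integral `a ↦ ∑ φ(u₂ a S³(u₁))`. -/
lemma IsLeftIntegral.comp_adjointOp (hφ : IsLeftIntegral R H φ) (u : H) :
    IsLeftIntegral R H (φ ∘ₗ adjointOp u) := by
  intro a
  let r : H ⊗[R] H →ₗ[R] Module.End R (H ⊗[R] H) := (LinearMap.mul R (H ⊗[R] H)).flip
  let P : WithConv (H →ₗ[R] Module.End R (H ⊗[R] H)) :=
    toConv (r ∘ₗ inclR.toLinearMap ∘ₗ antipode R ∘ₗ (antipodeSq R H).toLinearMap)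
  let Q : WithConv (H →ₗ[R] Module.End R (H ⊗[R] H)) :=
    toConv (r ∘ₗ inclL.toLinearMap ∘ₗ (antipodeSq R H).toLinearMap)
  let Q' : WithConv (H →ₗ[R] Module.End R (H ⊗[R] H)) := toConv (r ∘ₗ inclL.toLinearMap ∘ₗ antipode R)
  let L : WithConv (H →ₗ[R] Module.End R (H ⊗[R] H)) :=
    toConv (LinearMap.mul R (H ⊗[R] H) ∘ₗ inclR.toLinearMap)
  have hQ : Q * Q' = 1 := by
    ext c : 2
    rw [(ℛ R c).convMul_apply]
    refine LinearMap.ext fun z => ?_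
    have h1 := congr(antipode R $(sum_antipode_mul_eq_smul (ℛ R c)))
    have h2 := congr(z * inclL (R := R) $h1)
    simp only [map_sum, Finset.mul_sum, antipode_mul_antidistrib, map_mul, map_smul, antipode_one,
      map_one] at h2
    simp [Q, Q', r, LinearMap.sum_apply, Module.End.mul_apply, mul_assoc]
    simpa using h2
  have hPL : ∀ x u : H, ((P * Q) x * (Q' * L) u) (1 ⊗ₜ a) =
    ∑ i ∈ (ℛ R x).index, ∑ j ∈ (ℛ R u).index,
      (antipode R ((ℛ R u).left j) * antipode R (antipode R ((ℛ R x).right i))) ⊗ₜ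
      ((ℛ R u).right j * a * antipode R (antipode R (antipode R ((ℛ R x).left i)))) := by
    intro x u
    rw [(ℛ R x).convMul_apply, (ℛ R u).convMul_apply]
    simp [P, Q, Q', L, r, Finset.sum_mul, Finset.mul_sum]
    exact Finset.sum_comm
  have hstep : ∀ x u : H, sliceRight φ (inclR (R := R) u * comul a *
        inclR (R := R) (antipode R (antipode R (antipode R x)))) =
      sliceRight φ (((P * Q) x * (Q' * L) u) (1 ⊗ₜ a)) := by
    intro x u
    rw [hφ.sliceRight_inclR_mul_comul_mul_inclR, hPL]
    simp only [map_sum, sliceRight_tmul]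
  have hassoc : (P * Q) * (Q' * L) = P * L := by
    rw [mul_assoc, ← mul_assoc Q, hQ, one_mul]
  have hu := congr(sliceRight φ ($hassoc u (1 ⊗ₜ a)))
  rw [(ℛ R u).convMul_apply, (ℛ R u).convMul_apply] at hu
  change sliceRight (φ ∘ₗ adjointOp u) (comul a) = _
  have hs : ∀ z : H ⊗[R] H, sliceRight (φ ∘ₗ adjointOp u) z = ∑ i ∈ (ℛ R u).index,
      sliceRight φ (inclR (R := R) ((ℛ R u).right i) * z * inclR (R := R)
        (antipode R (antipode R (antipode R ((ℛ R u).left i))))) := by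
    intro z
    induction z with
    | zero => simp
    | tmul x y => simp [adjointOp_apply, Finset.sum_smul]
    | add x y hx hy => simp only [map_add, mul_add, add_mul, hx, hy, Finset.sum_add_distrib]
  rw [hs]
  simp only [hstep]
  simp only [LinearMap.sum_apply, map_sum] at hu
  rw [hu]
  simp [P, L, r, adjointOp_apply, Finset.sum_smul]

lemma sum_adjointOp_apply_antipodeSq (u : H) :
    ∑ i ∈ (ℛ R u).index, adjointOp (R := R) ((ℛ R u).right i)
      (antipode R (antipode R ((ℛ R u).left i))) = u := by
  let F : (H ⊗[R] H) ⊗[R] H →ₗ[R] H := LinearMap.mul' R H ∘ₗ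
    (TensorProduct.comm R H H).toLinearMap ∘ₗ
    ((antipodeSq R H).toLinearMap ∘ₗ LinearMap.mul' R H ∘ₗ (antipode R).lTensor H).rTensor H
  have hF : ∀ p v : H, adjointOp (R := R) v (antipode R (antipode R p)) =
      F ((TensorProduct.assoc R H H H).symm (p ⊗ₜ comul v)) := by
    intro p v
    rw [adjointOp_apply, ← (ℛ R v).eq]
    simp [F, TensorProduct.tmul_sum, antipode_mul_antidistrib, mul_assoc]
  have hS : (antipodeSq R H).toLinearMap ∘ₗ LinearMap.mul' R H ∘ₗ (antipode R).lTensor H ∘ₗ comul =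
      Algebra.linearMap R H ∘ₗ counit := by
    rw [mul_antipode_lTensor_comul]
    ext
    simp
  have h1 : ∑ i ∈ (ℛ R u).index, adjointOp (R := R) ((ℛ R u).right i)
      (antipode R (antipode R ((ℛ R u).left i))) =
      F ((TensorProduct.assoc R H H H).symm (comul.lTensor H (comul u))) := by
    conv_rhs => rw [← (ℛ R u).eq]
    simp only [hF, map_sum, LinearMap.lTensor_tmul]
  rw [h1, Coalgebra.coassoc_symm_apply]
  simp only [F, LinearMap.comp_apply]
  rw [← LinearMap.rTensor_comp_apply, LinearMap.comp_assoc, LinearMap.comp_assoc, hS,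
    LinearMap.rTensor_comp_apply, Coalgebra.rTensor_counit_comul]
  simp

lemma IsLeftIntegral.exists_apply_antipode_ne_zero (hφ : IsLeftIntegral R H φ) (h0 : φ ≠ 0) :
    ∃ ψ : H →ₗ[R] R, IsLeftIntegral R H ψ ∧ ∃ x : H, ψ (antipode R x) ≠ 0 := by
  by_contra! h
  apply h0
  ext u
  rw [← sum_adjointOp_apply_antipodeSq (R := R) u, map_sum]
  exact Finset.sum_eq_zero fun i _ => h _ (hφ.comp_adjointOp ((ℛ R u).right i)) _

end Existence

lemma Submodule.projective_and_finrank_baseChange_eq_one_of_injective {R V : Type*} [CommRing R]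
    [IsDedekindDomain R] [AddCommGroup V] [Module R V] (N : Submodule R V) [Nontrivial N]
    {f : N →ₗ[R] R} (hf : Function.Injective f) :
    Module.Projective R N ∧ Module.finrank (FractionRing R) (FractionRing R ⊗[R] N) = 1 := by
  have : Module.Finite R N := Module.Finite.of_injective f hf
  have : Module.IsTorsionFree R N := hf.moduleIsTorsionFree _ (map_smul f)
  have : Module.FinitePresentation R N := Module.finitePresentation_of_finite R N
  refine ⟨Module.Flat.projective_of_finitePresentation, ?_⟩
  rw [IsLocalization.finrank_eq (R := R) _ (nonZeroDivisors R) le_rfl,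
    IsLocalizedModule.finrank_eq (nonZeroDivisors R)
      (TensorProduct.mk R (FractionRing R) N 1) le_rfl]
  refine le_antisymm ?_ Module.finrank_pos
  exact (LinearMap.finrank_le_finrank_of_injective hf).trans (Module.finrank_self R).le

/-- **Proposition.** Let `R` be a Dedekind domain and `H` a Hopf algebra over `R`
which is projective as an `R`-module and possesses a non-zero left integral. Then
the module `I^l_H` of left integrals on `H` is a projective `R`-module of rank
one: `I^l_H ⊗_R K` is one-dimensional over the fraction field `K` of `R`. -/
theorem leftIntegrals_projective_rank_one
    (R H : Type*) [CommRing R] [IsDomain R] [IsDedekindDomain R]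
    [Ring H] [HopfAlgebra R H] [Module.Projective R H]
    (hne : ∃ φ : H →ₗ[R] R, φ ≠ 0 ∧ IsLeftIntegral R H φ) :
    Module.Projective R ↥(leftIntegrals R H) ∧
      Module.finrank (FractionRing R)
        (FractionRing R ⊗[R] ↥(leftIntegrals R H)) = 1 := by
  obtain ⟨φ, h0, hφ⟩ := hne
  obtain ⟨ψ, hψ, x, hx⟩ := hφ.exists_apply_antipode_ne_zero h0
  let ev : leftIntegrals R H →ₗ[R] R :=
    LinearMap.applyₗ (HopfAlgebra.antipode R x) ∘ₗ (leftIntegrals R H).subtype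
  have hev : Function.Injective ev := by
    rw [injective_iff_map_eq_zero]
    exact fun θ hθ => Subtype.ext (IsLeftIntegral.eq_zero_of_apply_antipode_eq_zero θ.2 hψ hx hθ)
  have : Nontrivial (leftIntegrals R H) :=
    ⟨⟨ψ, hψ⟩, 0, fun h => hx congr(ev $h)⟩
  exact (leftIntegrals R H).projective_and_finrank_baseChange_eq_one_of_injective hev
end

section
/- Let R be a Dedekind domain and H a Hopf algebra over R which is projective as an R-module and possesses a non-zero left integral. Then the module of left integrals respects base change: for every maximal ideal m of R with residue field k = R/m, the natural map I^l_H ⊗_R k → I^l_{H ⊗_R k} (induced by base change of linear forms) is an isomorphism, and for every prime ideal m the natural map (I^l_H)_m → I^l_{H_m} to the module of left integrals on the localized Hopf algebra H_m over R_m is an isomorphism. -/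
open TensorProduct

open TensorProduct

section
variable (R H S : Type*) [CommRing R] [Ring H] [HopfAlgebra R H] [CommRing S] [Algebra R S]

/-- By the hom-tensor adjunction, an `S`-linear form on the base change
`H_S = S ⊗[R] H` is the same as an `R`-linear map `φ : H → S`. Such a `φ`
corresponds to a left integral on the Hopf algebra `H_S` precisely when
`∑ φ(h₂) ⊗ h₁ = φ(h) ⊗ 1` holds in `S ⊗[R] H` for every `h : H`. -/
def IsLeftIntegralTo (φ : H →ₗ[R] S) : Prop :=
  ∀ h : H, (TensorProduct.comm R H S) ((LinearMap.lTensor H φ) (Coalgebra.comul h)) =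
    φ h ⊗ₜ[R] (1 : H)

/-- The `S`-module of left integrals on the base change `H_S = S ⊗[R] H`,
realized as `R`-linear maps `H → S` (see `IsLeftIntegralTo`). -/
noncomputable def leftIntegralsTo : Submodule S (H →ₗ[R] S) where
  carrier := {φ | IsLeftIntegralTo R H S φ}
  add_mem' := fun {φ} {ψ} hφ hψ h => by
    simp only [LinearMap.lTensor_add, LinearMap.add_apply, map_add, hφ h, hψ h, add_tmul]
  zero_mem' := fun h => by simp [IsLeftIntegralTo, LinearMap.lTensor_zero]
  smul_mem' := by
    intro s φ hφ h
    have key : ∀ z : H ⊗[R] H,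
        (TensorProduct.comm R H S) ((LinearMap.lTensor H (s • φ)) z) =
          s • (TensorProduct.comm R H S) ((LinearMap.lTensor H φ) z) := by
      intro z
      induction z with
      | zero => simp
      | tmul x y =>
          simp only [LinearMap.lTensor_tmul, LinearMap.smul_apply, TensorProduct.comm_tmul,
            smul_tmul']
      | add x y hx hy => simp only [map_add, hx, hy, smul_add]
    rw [key, hφ h]
    simp [smul_tmul', LinearMap.smul_apply]
end


namespace LeftIntegral

open Coalgebra HopfAlgebra WithConv

section Conv

variable {k A : Type*} [CommRing k] [Ring A] [HopfAlgebra k A]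

theorem toConv_comul :
    toConv (comul (R := k) (A := A)) =
      toConv (Algebra.TensorProduct.includeLeft : A →ₐ[k] A ⊗[k] A).toLinearMap *
        toConv (Algebra.TensorProduct.includeRight : A →ₐ[k] A ⊗[k] A).toLinearMap := by
  ext h
  rw [(ℛ k h).convMul_apply]
  simp [(ℛ k h).eq]

theorem toConv_algHom_mul_antipode {B : Type*} [Ring B] [Algebra k B] (f : A →ₐ[k] B) :
    toConv f.toLinearMap * toConv (f.toLinearMap ∘ₗ antipode k) = 1 := by
  ext h
  rw [(ℛ k h).convMul_apply]
  simp [← map_mul, ← map_sum, sum_mul_antipode_eq_algebraMap_counit (ℛ k h)]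

theorem toConv_algHom_antipode_mul {B : Type*} [Ring B] [Algebra k B] (f : A →ₐ[k] B) :
    toConv (f.toLinearMap ∘ₗ antipode k) * toConv f.toLinearMap = 1 := by
  ext h
  rw [(ℛ k h).convMul_apply]
  simp [← map_mul, ← map_sum, sum_antipode_mul_eq_algebraMap_counit (ℛ k h)]

/-- `∑ Δ(y₁) (1 ⊗ S(y₂)) = y ⊗ 1`. -/
theorem comul_mul_one_tmul_antipode {y : A} {ι : Type*} (r : Repr k y ι) :
    ∑ i ∈ r.index, comul (R := k) (r.left i) * ((1 : A) ⊗ₜ[k] antipode k (r.right i)) =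
      y ⊗ₜ[k] 1 := by
  have key := congr_arg (fun z ↦ toConv (Algebra.TensorProduct.includeLeft :
    A →ₐ[k] A ⊗[k] A).toLinearMap * z) (toConv_algHom_mul_antipode
    (Algebra.TensorProduct.includeRight : A →ₐ[k] A ⊗[k] A))
  simp only [← mul_assoc, ← toConv_comul, mul_one] at key
  have := congr($key y)
  rw [r.convMul_apply] at this
  simpa using this

/-- `∑ Δ(S(h₁)) (h₂ ⊗ 1) = 1 ⊗ S(h)`. -/
theorem comul_antipode_mul_tmul_one {h : A} {ι : Type*} (r : Repr k h ι) :
    ∑ i ∈ r.index, comul (R := k) (antipode k (r.left i)) * (r.right i ⊗ₜ[k] (1 : A)) =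
      1 ⊗ₜ[k] antipode k h := by
  have key := toConv_algHom_antipode_mul (Bialgebra.comulAlgHom k A)
  have h2 : toConv (Bialgebra.comulAlgHom k A).toLinearMap = toConv (comul (R := k) (A := A)) := rfl
  rw [h2, toConv_comul, ← mul_assoc] at key
  have h3 := left_inv_eq_right_inv key (toConv_algHom_mul_antipode
    (Algebra.TensorProduct.includeRight : A →ₐ[k] A ⊗[k] A))
  have := congr($h3 h)
  rw [r.convMul_apply] at this
  simpa using this

end Conv

section Identities

variable {k A : Type*} [CommRing k] [Ring A] [HopfAlgebra k A]

/-- `w ↦ (id ⊗ a)(w)` commutes with right multiplication on the first factor. -/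
theorem rid_lTensor_mul_tmul_one (a : A →ₗ[k] k) (w : A ⊗[k] A) (c : A) :
    TensorProduct.rid k A (LinearMap.lTensor A a (w * (c ⊗ₜ 1))) =
      TensorProduct.rid k A (LinearMap.lTensor A a w) * c := by
  induction w with
  | zero => simp
  | tmul x y => simp
  | add x y hx hy => simp only [add_mul, map_add, hx, hy]

/-- `∑ x₁ a(x₂ S(h)) = ∑ a(x S(h₁)) h₂` for a left integral `a`. -/
theorem rid_lTensor_comul_mul_antipode {a : A →ₗ[k] k} (ha : IsLeftIntegral k A a) (x : A) {h : A}
    {ι : Type*} (r : Repr k h ι) :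
    TensorProduct.rid k A (LinearMap.lTensor A a (comul x * (1 ⊗ₜ antipode k h))) =
      ∑ i ∈ r.index, a (x * antipode k (r.left i)) • r.right i := by
  rw [← comul_antipode_mul_tmul_one r, Finset.mul_sum]
  simp only [map_sum, ← mul_assoc, ← Bialgebra.comul_mul, rid_lTensor_mul_tmul_one]
  refine Finset.sum_congr rfl fun i _ ↦ ?_
  rw [ha, smul_mul_assoc, one_mul]

/-- `∑ t(x₁) a(x₂ S(h)) = t(h) a(x)` for left integrals `a` and `t`. -/
theorem apply_rid_lTensor_comul_mul_antipode {a t : A →ₗ[k] k} (ha : IsLeftIntegral k A a)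
    (ht : IsLeftIntegral k A t) (x h : A) :
    t (TensorProduct.rid k A (LinearMap.lTensor A a (comul x * (1 ⊗ₜ antipode k h)))) =
      t h * a x := by
  rw [rid_lTensor_comul_mul_antipode ha x (ℛ k h), map_sum]
  have h1 := congr_arg (fun z ↦ a (x * antipode k z)) (ht h)
  simp only [← (ℛ k h).eq, map_sum, LinearMap.lTensor_tmul, TensorProduct.rid_tmul, map_smul,
    Finset.mul_sum, mul_smul_comm, antipode_one, mul_one] at h1
  simpa [mul_comm] using h1

/-- `∑ a(y₁) t(h y₂) = t(y) a(S(h))` for left integrals `a` and `t`. -/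
theorem sum_apply_mul_apply_mul {a t : A →ₗ[k] k} (ha : IsLeftIntegral k A a)
    (ht : IsLeftIntegral k A t) (h : A) {y : A} {ι : Type*} (r : Repr k y ι) :
    ∑ i ∈ r.index, a (r.left i) * t (h * r.right i) = t y * a (antipode k h) := by
  have h1 := congr_arg (fun z ↦ t (TensorProduct.rid k A (LinearMap.lTensor A a
    (z * (1 ⊗ₜ antipode k h))))) (comul_mul_one_tmul_antipode r)
  simp only [Finset.sum_mul, map_sum, mul_assoc, Algebra.TensorProduct.tmul_mul_tmul, one_mul,
    mul_one, ← antipode_mul_antidistrib, apply_rid_lTensor_comul_mul_antipode ha ht,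
    LinearMap.lTensor_tmul, TensorProduct.rid_tmul, map_smul, smul_eq_mul] at h1
  simpa [mul_comm] using h1

/-- The right translate `y ↦ ∑ t(y₁) y₂` by a linear form `t`. -/
noncomputable def translate (t : A →ₗ[k] k) : A →ₗ[k] A :=
  (TensorProduct.lid k A).toLinearMap ∘ₗ LinearMap.rTensor A t ∘ₗ comul

theorem toConv_comp_translate {B : Type*} [Ring B] [Algebra k B] (f : A →ₗ[k] B)
    (t : A →ₗ[k] k) :
    toConv (f ∘ₗ translate t) = toConv (Algebra.linearMap k B ∘ₗ t) * toConv f := by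
  ext h
  rw [(ℛ k h).convMul_apply]
  simp [translate, ← (ℛ k h).eq, ← Algebra.smul_def]

/-- Translates of left integrals are left integrals. -/
theorem isLeftIntegral_comp_translate {t : A →ₗ[k] k} (ht : IsLeftIntegral k A t)
    (f : A →ₗ[k] k) : IsLeftIntegral k A (f ∘ₗ translate t) := by
  intro h
  let i₁ : A →ₐ[k] A ⊗[k] A := Algebra.TensorProduct.includeLeft
  let i₂ : A →ₐ[k] A ⊗[k] A := Algebra.TensorProduct.includeRight
  have h1 : toConv i₁.toLinearMap * toConv (Algebra.linearMap k (A ⊗[k] A) ∘ₗ t) =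
      toConv (Algebra.linearMap k (A ⊗[k] A) ∘ₗ t) := by
    ext x
    rw [(ℛ k x).convMul_apply]
    have := congr_arg i₁ (ht x)
    rw [← (ℛ k x).eq] at this
    simpa [Algebra.algebraMap_eq_smul_one] using this
  have h2 : toConv i₁.toLinearMap * toConv (i₂.toLinearMap ∘ₗ translate t) =
      toConv (i₂.toLinearMap ∘ₗ translate t) := by
    rw [toConv_comp_translate, ← mul_assoc, h1]
  have h3 := congr($h2 h)
  rw [(ℛ k h).convMul_apply] at h3
  have h4 := congr_arg (fun z ↦ TensorProduct.rid k A (LinearMap.lTensor A f z)) h3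
  rw [← (ℛ k h).eq]
  simpa [i₁, i₂] using h4

/-- `∑ t(y₁) S(y₂) y₃ = t(y) 1`. -/
theorem sum_antipode_translate_mul (t : A →ₗ[k] k) {y : A} {ι : Type*} (r : Repr k y ι) :
    ∑ i ∈ r.index, antipode k (translate t (r.left i)) * r.right i = t y • (1 : A) := by
  have h1 : toConv (antipode k ∘ₗ translate t) * toConv (LinearMap.id (M := A)) =
      toConv (Algebra.linearMap k A ∘ₗ t) := by
    rw [toConv_comp_translate, mul_assoc, LinearMap.antipode_mul_id, mul_one]
  have h2 := congr($h1 y)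
  rw [r.convMul_apply] at h2
  simpa [Algebra.algebraMap_eq_smul_one] using h2

theorem sum_smul_translate [Module.Free k A] {t t' : A →ₗ[k] k} (ht : IsLeftIntegral k A t)
    (ht' : IsLeftIntegral k A t') (h : A) {y : A} {ι : Type*} (r : Repr k y ι) :
    ∑ i ∈ r.index, t' (h * r.right i) • translate t (r.left i) =
      t' y • translate t (antipode k h) := by
  rw [← sub_eq_zero, ← Module.forall_dual_apply_eq_zero_iff k]
  intro f
  have := sum_apply_mul_apply_mul (isLeftIntegral_comp_translate ht f) ht' h r
  simp only [LinearMap.comp_apply] at this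
  rw [map_sub, sub_eq_zero]
  simpa [mul_comm] using this

/-- If `∑ t(h bᵢ) aᵢ = 0` for all `h`, then `∑ t(h S(aᵢ) bᵢ) = 0` for all `h`. -/
theorem apply_mul_antipode_eq_zero [Module.Free k A] (t : A →ₗ[k] k) (d : A ⊗[k] A)
    (hd : ∀ h : A, TensorProduct.rid k A (LinearMap.lTensor A (t ∘ₗ LinearMap.mulLeft k h) d) = 0)
    (h : A) :
    t (h * LinearMap.mul' k A (LinearMap.rTensor A (antipode k) d)) = 0 := by
  classical
  let b := Module.Free.chooseBasis k A
  obtain ⟨c, rfl⟩ := TensorProduct.eq_repr_basis_left b d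
  have hc : ∀ h i, t (h * c i) = 0 := by
    intro h i
    have h1 := congr_arg (fun z ↦ b.repr z i) (hd h)
    by_cases h0 : c i = 0
    · simp [h0]
    · simpa [Finsupp.sum, Finsupp.single_apply, h0] using h1
  simp [Finsupp.sum, Finset.mul_sum, ← mul_assoc, hc]

/-- Uniqueness of left integrals. -/
theorem apply_mul_apply_comm [IsDomain k] [Module.Free k A] {t t' : A →ₗ[k] k}
    (ht : IsLeftIntegral k A t) (ht' : IsLeftIntegral k A t') (y y' : A) :
    t y * t' y' = t y' * t' y := by
  by_cases h0 : t' = 0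
  · simp [h0]
  obtain ⟨h, hh⟩ : ∃ h, t' h ≠ 0 := by
    by_contra! hc
    exact h0 (LinearMap.ext hc)
  let w (y : A) : A ⊗[k] A := LinearMap.rTensor A (translate t) (comul y)
  have hw (y h : A) : TensorProduct.rid k A
      (LinearMap.lTensor A (t' ∘ₗ LinearMap.mulLeft k h) (w y)) =
        t' y • translate t (antipode k h) := by
    rw [← sum_smul_translate ht ht' h (ℛ k y)]
    simp [w, ← (ℛ k y).eq]
  have hw' (y : A) : LinearMap.mul' k A (LinearMap.rTensor A (antipode k) (w y)) =
      t y • (1 : A) := by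
    rw [← sum_antipode_translate_mul t (ℛ k y)]
    simp [w, ← (ℛ k y).eq]
  have key := apply_mul_antipode_eq_zero t' (t' y' • w y - t' y • w y') (fun h ↦ by
    simp only [map_sub, map_smul, hw, smul_smul, mul_comm, sub_self]) h
  simp only [map_sub, map_smul, hw', mul_sub, mul_smul_comm, mul_one, smul_eq_mul] at key
  rw [← mul_assoc, ← mul_assoc, ← sub_mul] at key
  have := (mul_eq_zero.mp key).resolve_right hh
  linear_combination this

end Identities

section BaseChange

variable {R H : Type*} [CommRing R] [Ring H] [HopfAlgebra R H]

theorem isLeftIntegralTo_iff_sum {S : Type*} [CommRing S] [Algebra R S] {φ : H →ₗ[R] S} :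
    IsLeftIntegralTo R H S φ ↔ ∀ h : H, ∑ i ∈ (ℛ R h).index,
      φ ((ℛ R h).right i) ⊗ₜ[R] (ℛ R h).left i = φ h ⊗ₜ[R] (1 : H) := by
  refine forall_congr' fun h ↦ ?_
  conv_lhs => rw [← (ℛ R h).eq]
  simp

/-- Postcomposition with an algebra homomorphism preserves left integrals. -/
theorem isLeftIntegralTo_algHom_comp {S T : Type*} [CommRing S] [Algebra R S] [CommRing T]
    [Algebra R T] {φ : H →ₗ[R] S} (hφ : IsLeftIntegralTo R H S φ) (g : S →ₐ[R] T) :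
    IsLeftIntegralTo R H T (g.toLinearMap ∘ₗ φ) := by
  rw [isLeftIntegralTo_iff_sum] at hφ ⊢
  intro h
  simpa using congr_arg (LinearMap.rTensor H g.toLinearMap) (hφ h)

theorem isLeftIntegralTo_linearMap_comp {φ : H →ₗ[R] R} (hφ : IsLeftIntegral R H φ)
    (S : Type*) [CommRing S] [Algebra R S] :
    IsLeftIntegralTo R H S (Algebra.linearMap R S ∘ₗ φ) := by
  rw [isLeftIntegralTo_iff_sum]
  intro h
  have h1 := congr_arg (fun z ↦ (1 : S) ⊗ₜ[R] z) (hφ h)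
  rw [← (ℛ R h).eq] at h1
  simpa [TensorProduct.tmul_sum, Algebra.algebraMap_eq_smul_one, TensorProduct.smul_tmul]
    using h1

/-- The linear extension of a left integral is a left integral on the base change. -/
theorem isLeftIntegral_liftBaseChange {S : Type*} [CommRing S] [Algebra R S] {φ : H →ₗ[R] S}
    (hφ : IsLeftIntegralTo R H S φ) :
    IsLeftIntegral S (S ⊗[R] H) (LinearMap.liftBaseChange S φ) := by
  rw [isLeftIntegralTo_iff_sum] at hφ
  intro z
  induction z with
  | zero => simp
  | add x y hx hy => simp only [map_add, hx, hy, add_smul]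
  | tmul c h =>
    have h1 := congr_arg (fun z ↦ c • z) (hφ h)
    rw [TensorProduct.comul_tmul, ← (ℛ R h).eq]
    simpa [TensorProduct.tmul_sum, Finset.smul_sum, TensorProduct.smul_tmul',
      Algebra.TensorProduct.one_def] using h1

theorem apply_mul_apply_comm_of_field {K : Type*} [Field K] [Algebra R K] {φ ψ : H →ₗ[R] K}
    (hφ : IsLeftIntegralTo R H K φ) (hψ : IsLeftIntegralTo R H K ψ) (x y : H) :
    φ x * ψ y = φ y * ψ x := by
  simpa using apply_mul_apply_comm (isLeftIntegral_liftBaseChange hφ)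
    (isLeftIntegral_liftBaseChange hψ) (1 ⊗ₜ x) (1 ⊗ₜ y)

/-- Uniqueness of left integrals with values in a domain. -/
theorem apply_mul_apply_comm_of_isDomain {S : Type*} [CommRing S] [IsDomain S] [Algebra R S]
    {φ ψ : H →ₗ[R] S} (hφ : IsLeftIntegralTo R H S φ) (hψ : IsLeftIntegralTo R H S ψ)
    (x y : H) : φ x * ψ y = φ y * ψ x := by
  apply IsFractionRing.injective S (FractionRing S)
  simpa using apply_mul_apply_comm_of_field
    (isLeftIntegralTo_algHom_comp hφ (IsScalarTower.toAlgHom R S (FractionRing S)))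
    (isLeftIntegralTo_algHom_comp hψ (IsScalarTower.toAlgHom R S (FractionRing S))) x y

/-- If the values of the left integrals generate the unit ideal, then the module of left integrals
respects base change to any domain `S`. -/
theorem exists_baseChange_equiv [IsDomain R] {ι : Type*} [Fintype ι]
    (φ : ι → leftIntegrals R H) (x : ι → H) (hx : ∑ i, (φ i : H →ₗ[R] R) (x i) = 1)
    (S : Type*) [CommRing S] [IsDomain S] [Algebra R S] :
    ∃ e : (S ⊗[R] leftIntegrals R H) ≃ₗ[S] leftIntegralsTo R H S,
      ∀ (c : S) (φ : leftIntegrals R H),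
        (e (c ⊗ₜ[R] φ) : H →ₗ[R] S) =
          c • ((Algebra.linearMap R S).comp (φ : H →ₗ[R] R)) := by
  let g : leftIntegrals R H →ₗ[R] leftIntegralsTo R H S :=
    { toFun φ := ⟨Algebra.linearMap R S ∘ₗ φ.1, isLeftIntegralTo_linearMap_comp φ.2 S⟩
      map_add' φ ψ := by ext; simp
      map_smul' r φ := by ext; simp [Algebra.smul_def] }
  let f : (S ⊗[R] leftIntegrals R H) →ₗ[S] leftIntegralsTo R H S := LinearMap.liftBaseChange S g
  have hf (c : S) (φ : leftIntegrals R H) : (f (c ⊗ₜ[R] φ) : H →ₗ[R] S) =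
      c • ((Algebra.linearMap R S).comp (φ : H →ₗ[R] R)) := by
    simp [f, g]
  let f' : leftIntegralsTo R H S →ₗ[S] (S ⊗[R] leftIntegrals R H) :=
    { toFun ψ := ∑ i, ψ.1 (x i) ⊗ₜ[R] φ i
      map_add' ψ ψ' := by simp [TensorProduct.add_tmul, Finset.sum_add_distrib]
      map_smul' c ψ := by simp [Finset.smul_sum, TensorProduct.smul_tmul'] }
  refine ⟨LinearEquiv.ofLinearMap f f' ?_ ?_, hf⟩
  · ext ψ h
    have h1 (i : ι) : ψ.1 (x i) * algebraMap R S ((φ i).1 h) =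
        ψ.1 h * algebraMap R S ((φ i).1 (x i)) :=
      apply_mul_apply_comm_of_isDomain ψ.2 (isLeftIntegralTo_linearMap_comp (φ i).2 S) (x i) h
    have h2 : f (f' ψ) = ∑ i, f (ψ.1 (x i) ⊗ₜ[R] φ i) := map_sum f _ _
    suffices ∑ i, ψ.1 (x i) * algebraMap R S ((φ i).1 h) = ψ.1 h by simpa [h2, hf] using this
    rw [Finset.sum_congr rfl fun i _ ↦ h1 i, ← Finset.mul_sum, ← map_sum, hx, map_one, mul_one]
  · ext ψ
    have h1 (i : ι) : ψ.1 (x i) • φ i = (φ i).1 (x i) • ψ := by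
      ext h
      have := apply_mul_apply_comm_of_isDomain (isLeftIntegralTo_linearMap_comp ψ.2 R)
        (isLeftIntegralTo_linearMap_comp (φ i).2 R) (x i) h
      simpa [mul_comm] using this
    have h2 : ∑ i, ψ.1 (x i) • φ i = ψ := by
      simp only [h1, ← Finset.sum_smul, hx, one_smul]
    have h3 : f' (f (1 ⊗ₜ[R] ψ)) = ∑ i, (1 : S) ⊗ₜ[R] (ψ.1 (x i) • φ i) := by
      simp [f', hf, Algebra.algebraMap_eq_smul_one, TensorProduct.smul_tmul]
    rw [← TensorProduct.tmul_sum, h2] at h3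
    exact h3

end BaseChange

section Dedekind

variable {R H : Type*} [CommRing R] [Ring H] [HopfAlgebra R H]

/-- Division of a left integral by a nonzero scalar. -/
theorem isLeftIntegral_of_smul [IsDomain R] [Module.IsTorsionFree R H] {φ : H →ₗ[R] R} {r : R}
    (hr : r ≠ 0) (h : IsLeftIntegral R H (r • φ)) : IsLeftIntegral R H φ := by
  intro x
  have := h x
  simp only [LinearMap.lTensor_smul, LinearMap.smul_apply, map_smul, smul_assoc] at this
  exact smul_right_injective H hr this

/-- The values of the left integrals generate the unit ideal. -/
theorem span_range_leftIntegrals_eq_top [IsDedekindDomain R]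
    [Module.IsTorsionFree R H] {φ : H →ₗ[R] R} (h0 : φ ≠ 0) (hφ : IsLeftIntegral R H φ) :
    Ideal.span {c : R | ∃ (ψ : leftIntegrals R H) (h : H), ψ.1 h = c} = ⊤ := by
  obtain ⟨h₀, hh₀⟩ : ∃ h, φ h ≠ 0 := by
    by_contra! hc
    exact h0 (LinearMap.ext hc)
  set L := Ideal.span {c : R | ∃ (ψ : leftIntegrals R H) (h : H), ψ.1 h = c}
  let J : Ideal R := LinearMap.range φ
  set r := φ h₀
  obtain ⟨J', hJ'⟩ : J ∣ Ideal.span {r} :=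
    Ideal.dvd_span_singleton.mpr (LinearMap.mem_range_self φ h₀)
  have hdiv (c : R) (hc : c ∈ J') : ∃ ψ : H →ₗ[R] R, r • ψ = c • φ := by
    have h1 (h : H) : (c • φ) h ∈ R ∙ r := by
      change c * φ h ∈ Ideal.span {r}
      rw [hJ', mul_comm c]
      exact Ideal.mul_mem_mul (LinearMap.mem_range_self φ h) hc
    refine ⟨(LinearEquiv.toSpanNonzeroSingleton R R r hh₀).symm.toLinearMap ∘ₗ
      (c • φ).codRestrict _ h1, LinearMap.ext fun h ↦ ?_⟩
    have h2 := LinearEquiv.apply_symm_apply (LinearEquiv.toSpanNonzeroSingleton R R r hh₀)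
      ((c • φ).codRestrict _ h1 h)
    rw [LinearEquiv.toSpanNonzeroSingleton_apply, Subtype.ext_iff] at h2
    simpa [mul_comm] using h2
  have hle : J * J' ≤ Ideal.span {r} * L := by
    rw [Ideal.mul_le]
    rintro _ ⟨h, rfl⟩ c hc
    obtain ⟨ψ, hψ⟩ := hdiv c hc
    have hψ' : IsLeftIntegral R H ψ := by
      refine isLeftIntegral_of_smul hh₀ ?_
      rw [hψ]
      exact (leftIntegrals R H).smul_mem c hφ
    have h1 : φ h * c = r * ψ h := by
      simpa [mul_comm] using congr($hψ h).symm
    rw [h1]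
    exact Ideal.mul_mem_mul (Ideal.mem_span_singleton_self r)
      (Ideal.subset_span ⟨⟨ψ, hψ'⟩, h, rfl⟩)
  rw [← hJ', Ideal.span_singleton_le_iff_mem, Ideal.mem_span_singleton_mul] at hle
  obtain ⟨z, hz, hz'⟩ := hle
  rw [Ideal.eq_top_iff_one]
  rwa [mul_right_eq_self₀.mp hz' |>.resolve_right hh₀] at hz

theorem exists_sum_leftIntegrals_eq_one [IsDedekindDomain R]
    [Module.IsTorsionFree R H] {φ : H →ₗ[R] R} (h0 : φ ≠ 0) (hφ : IsLeftIntegral R H φ) :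
    ∃ (n : ℕ) (ψ : Fin n → leftIntegrals R H) (x : Fin n → H),
      ∑ i, (ψ i : H →ₗ[R] R) (x i) = 1 := by
  have h1 : (1 : R) ∈ Ideal.span {c : R | ∃ (ψ : leftIntegrals R H) (h : H), ψ.1 h = c} := by
    rw [span_range_leftIntegrals_eq_top h0 hφ]
    trivial
  obtain ⟨n, f, g, hfg⟩ := Submodule.mem_span_set'.mp h1
  choose ψ x hψ using fun i ↦ (g i).2
  exact ⟨n, fun i ↦ f i • ψ i, x, by simpa [hψ] using hfg⟩

end Dedekind

end LeftIntegral

/-- **Proposition.** Let `R` be a Dedekind domain and `H` an `R`-projective Hopf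
algebra with a non-zero left integral. Then the module of left integrals respects
base change: for every maximal ideal `m` with residue field `k = R/m` the natural
map `I^l_H ⊗_R k → I^l_{H ⊗_R k}` (sending `c ⊗ φ` to `c • (algebraMap R k ∘ φ)`,
where a left integral on the base change `H ⊗_R k` is realized as an `R`-linear
map `H → k`, see `IsLeftIntegralTo`) is an isomorphism, and likewise
`(I^l_H)_m ≅ I^l_{H_m}` for every prime ideal `m`. -/
theorem leftIntegrals_respect_base_change
    (R H : Type*) [CommRing R] [IsDomain R] [IsDedekindDomain R]
    [Ring H] [HopfAlgebra R H] [Module.Projective R H]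
    (hne : ∃ φ : H →ₗ[R] R, φ ≠ 0 ∧ IsLeftIntegral R H φ) :
    (∀ m : Ideal R, m.IsMaximal →
      ∃ e : ((R ⧸ m) ⊗[R] ↥(leftIntegrals R H)) ≃ₗ[R ⧸ m]
          ↥(leftIntegralsTo R H (R ⧸ m)),
        ∀ (c : R ⧸ m) (φ : ↥(leftIntegrals R H)),
          (e (c ⊗ₜ[R] φ) : H →ₗ[R] R ⧸ m) =
            c • ((Algebra.linearMap R (R ⧸ m)).comp (φ : H →ₗ[R] R))) ∧
    (∀ (m : Ideal R) [m.IsPrime],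
      ∃ e : (Localization.AtPrime m ⊗[R] ↥(leftIntegrals R H)) ≃ₗ[Localization.AtPrime m]
          ↥(leftIntegralsTo R H (Localization.AtPrime m)),
        ∀ (c : Localization.AtPrime m) (φ : ↥(leftIntegrals R H)),
          (e (c ⊗ₜ[R] φ) : H →ₗ[R] Localization.AtPrime m) =
            c • ((Algebra.linearMap R (Localization.AtPrime m)).comp (φ : H →ₗ[R] R))) := by
  obtain ⟨φ, h0, hφ⟩ := hne
  obtain ⟨n, ψ, x, hx⟩ := LeftIntegral.exists_sum_leftIntegrals_eq_one h0 hφ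
  refine ⟨fun m hm ↦ ?_, fun m _ ↦ ?_⟩
  · have := hm.isPrime
    exact LeftIntegral.exists_baseChange_equiv ψ x hx (R ⧸ m)
  · have : IsDomain (Localization.AtPrime m) :=
      IsLocalization.isDomain_localization m.primeCompl_le_nonZeroDivisors
    exact LeftIntegral.exists_baseChange_equiv ψ x hx (Localization.AtPrime m)
end
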